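/- arXiv:2104.00552 — 4 statements merged into one kernel-verified Lean document; each statement's English description precedes it below -/
import Mathlib

section
/- Let T be a tree of order n ≥ 1 and let p ≥ 0. For the graph T ∪ pK_1 obtained from T by adding p isolated vertices, B(T ∪ pK_1) = Σ_{i=0}^{p} C(p,i) · B_{n+i−1} and T(T ∪ pK_1) = Σ_{i=0}^{p} C(p,i) · B_{n+i}, where C(p,i) is the binomial coefficient and B_k is the k-th Bell number. -/
open Finset SimpleGraph

/-- A coloring partition of `G`: a partition of the vertex set into (nonempty)
independent (stable) sets. -/
def IsStablePartition {V : Type*} [Fintype V] [DecidableEq V] (G : SimpleGraph V)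
    (P : Finpartition (univ : Finset V)) : Prop :=
  ∀ t ∈ P.parts, ∀ u ∈ t, ∀ v ∈ t, ¬ G.Adj u v

open scoped Classical in
/-- `colB G` : the number of coloring partitions of `G`. -/
noncomputable def colB {V : Type*} [Fintype V] [DecidableEq V] (G : SimpleGraph V) : ℕ :=
  (univ.filter (IsStablePartition G)).card

open scoped Classical in
/-- `colT G` : the total number of blocks summed over all coloring partitions of `G`. -/
noncomputable def colT {V : Type*} [Fintype V] [DecidableEq V] (G : SimpleGraph V) : ℕ :=
  ∑ P ∈ univ.filter (IsStablePartition G), P.parts.card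

/-- `colA G = colT G / colB G` : the average number of blocks. -/
noncomputable def colA {V : Type*} [Fintype V] [DecidableEq V] (G : SimpleGraph V) : ℚ :=
  (colT G : ℚ) / (colB G : ℚ)

/-- The `n`-th Bell number: the number of partitions of an `n`-element set. -/
noncomputable def bell (n : ℕ) : ℕ :=
  Fintype.card (Finpartition (univ : Finset (Fin n)))

/-- The disjoint union of `G` with `p` isolated vertices (`G ∪ pK₁`). -/
def unionIsolated {V : Type*} (G : SimpleGraph V) (p : ℕ) : SimpleGraph (V ⊕ Fin p) :=
  SimpleGraph.fromRel (fun x y => ∃ a b, x = Sum.inl a ∧ y = Sum.inl b ∧ G.Adj a b)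

/-- `Hgraph n r` : the graph obtained from the disjoint union of the cycle `C_n` and the
path `P_r` by adding an edge between one endpoint of the path (vertex `0`) and one vertex
of the cycle (vertex `0`). -/
def Hgraph (n r : ℕ) : SimpleGraph (Fin n ⊕ Fin r) :=
  SimpleGraph.fromRel (fun x y =>
    (∃ a b, x = Sum.inl a ∧ y = Sum.inl b ∧ (cycleGraph n).Adj a b) ∨
    (∃ a b, x = Sum.inr a ∧ y = Sum.inr b ∧ (pathGraph r).Adj a b) ∨
    (∃ (a : Fin n) (b : Fin r), a.val = 0 ∧ b.val = 0 ∧ x = Sum.inl a ∧ y = Sum.inr b))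


open scoped Nat

/-- An injective labelling of the blocks of a stable partition is the same as a proper coloring. -/
noncomputable def stablePartitionEmbeddingEquivColoring {V α : Type*} [Fintype V] [DecidableEq V]
    (G : SimpleGraph V) :
    (Σ P : {P : Finpartition (univ : Finset V) // IsStablePartition G P}, (P.1.parts ↪ α)) ≃
      G.Coloring α :=
  Equiv.ofBijective
    (fun Q => Coloring.mk (fun v => Q.2 ⟨Q.1.1.part v, Q.1.1.part_mem.2 (mem_univ v)⟩) (by
      intro u v huv h
      have h' : Q.1.1.part u = Q.1.1.part v := congrArg Subtype.val (Q.2.injective h)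
      exact Q.1.2 _ (Q.1.1.part_mem.2 (mem_univ v)) u (h' ▸ Q.1.1.mem_part (mem_univ u)) v
        (Q.1.1.mem_part (mem_univ v)) huv))
    (by
      classical
      constructor
      · rintro ⟨⟨P, hP⟩, f⟩ ⟨⟨Q, hQ⟩, g⟩ h
        have hfg : ∀ v, f ⟨P.part v, P.part_mem.2 (mem_univ v)⟩ =
            g ⟨Q.part v, Q.part_mem.2 (mem_univ v)⟩ := fun v => DFunLike.congr_fun h v
        have hpart : ∀ v, P.part v = Q.part v := by
          intro v
          ext u
          rw [P.mem_part_iff_part_eq_part (mem_univ u) (mem_univ v),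
            Q.mem_part_iff_part_eq_part (mem_univ u) (mem_univ v)]
          constructor
          · intro huv
            have : g ⟨Q.part u, Q.part_mem.2 (mem_univ u)⟩ =
                g ⟨Q.part v, Q.part_mem.2 (mem_univ v)⟩ := by
              rw [← hfg, ← hfg]; congr 2
            exact congrArg Subtype.val (g.injective this)
          · intro huv
            have : f ⟨P.part u, P.part_mem.2 (mem_univ u)⟩ =
                f ⟨P.part v, P.part_mem.2 (mem_univ v)⟩ := by
              rw [hfg, hfg]; congr 2
            exact congrArg Subtype.val (f.injective this)
        have hPQ : P = Q := by
          ext t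
          constructor
          · intro ht
            obtain ⟨v, -, rfl⟩ := P.part_surjOn ht
            rw [hpart v]
            exact Q.part_mem.2 (mem_univ v)
          · intro ht
            obtain ⟨v, -, rfl⟩ := Q.part_surjOn ht
            rw [← hpart v]
            exact P.part_mem.2 (mem_univ v)
        subst hPQ
        have : f = g := by
          ext ⟨t, ht⟩
          obtain ⟨v, -, rfl⟩ := P.part_surjOn ht
          exact hfg v
        rw [this]
      · intro c
        let P : Finpartition (univ : Finset V) := Finpartition.ofSetoid (Setoid.ker c)
        have hP : ∀ u v, u ∈ P.part v ↔ c v = c u := fun u v =>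
          Finpartition.mem_part_ofSetoid_iff_rel
        have hstable : IsStablePartition G P := by
          intro t ht u hu v hv huv
          rw [← P.part_eq_of_mem ht hv, hP] at hu
          exact c.valid huv hu.symm
        have hrep : ∀ t : P.parts, ∃ v, P.part v = t.1 := fun t => by
          obtain ⟨v, -, hv⟩ := P.part_surjOn t.2
          exact ⟨v, hv⟩
        choose r hr using hrep
        refine ⟨⟨⟨P, hstable⟩, ⟨fun t => c (r t), fun s t hst => ?_⟩⟩, ?_⟩
        · apply Subtype.ext
          rw [← hr s, ← hr t, ← P.mem_part_iff_part_eq_part (mem_univ _) (mem_univ _), hP]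
          exact hst.symm
        · ext v
          change c (r _) = c v
          rw [← hP, hr]
          exact P.mem_part (mem_univ v))

open scoped Classical in
theorem card_coloring_eq_sum_descFactorial {V : Type*} [Fintype V] [DecidableEq V]
    (G : SimpleGraph V) (x : ℕ) :
    Nat.card (G.Coloring (Fin x)) =
      ∑ P ∈ univ.filter (IsStablePartition G), x.descFactorial P.parts.card := by
  rw [← Nat.card_congr (stablePartitionEmbeddingEquivColoring G), Nat.card_sigma]
  simp only [Nat.card_eq_fintype_card, Fintype.card_embedding_eq, Fintype.card_coe,
    Fintype.card_fin]
  exact (Finset.sum_subtype (univ.filter (IsStablePartition G)) (by simp)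
    fun P => x.descFactorial P.parts.card).symm

/-- A proper coloring is a proper coloring of the complement of a pendant vertex together with
a color for that vertex other than the color of its unique neighbor. -/
noncomputable def coloringEquivOfPendant {V α : Type*} (G : SimpleGraph V) {u v : V}
    (huv : G.Adj v u) (huniq : ∀ w, G.Adj v w → w = u) :
    G.Coloring α ≃
      Σ c : (G.induce {v}ᶜ).Coloring α, {a : α // a ≠ c ⟨u, huv.ne'⟩} :=
  Equiv.ofBijective
    (fun c => ⟨c.comp (Embedding.induce _).toHom, ⟨c v, c.valid huv⟩⟩)
    (by
      classical
      constructor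
      · intro c d h
        obtain ⟨h₁, h₂⟩ := Sigma.mk.inj_iff.1 h
        have hv : c v = d v :=
          congrArg (fun q : Σ c : (G.induce {v}ᶜ).Coloring α, {a : α // a ≠ c ⟨u, huv.ne'⟩} =>
            q.2.1) h
        ext w
        by_cases hw : w = v
        · rw [hw, hv]
        · exact DFunLike.congr_fun h₁ ⟨w, hw⟩
      · rintro ⟨d, a, ha⟩
        obtain ⟨c, hc, hcv⟩ : ∃ c : G.Coloring α,
            c.comp (Embedding.induce ({v}ᶜ : Set V)).toHom = d ∧ c v = a := by
          refine ⟨Coloring.mk (fun w => if h : w = v then a else d ⟨w, h⟩) ?_, ?_, ?_⟩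
          · intro x y hxy
            by_cases hx : x = v
            · subst hx
              obtain rfl := huniq y hxy
              simpa [huv.ne'] using ha
            · by_cases hy : y = v
              · subst hy
                obtain rfl := huniq x hxy.symm
                simpa [huv.ne'] using ha.symm
              · simpa [hx, hy] using d.valid (v := ⟨x, hx⟩) (w := ⟨y, hy⟩) hxy
          · ext w
            exact dif_neg w.2
          · exact dif_pos rfl
        subst hc
        subst hcv
        exact ⟨c, rfl⟩)

theorem SimpleGraph.IsTree.card_coloring {V : Type*} [Fintype V] {T : SimpleGraph V}
    (hT : T.IsTree) (x : ℕ) :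
    Nat.card (T.Coloring (Fin x)) = x * (x - 1) ^ (Fintype.card V - 1) := by
  classical
  induction hm : Fintype.card V - 1 generalizing V with
  | zero =>
    have := hT.connected.nonempty
    have hone : Fintype.card V = 1 := by have := Fintype.card_pos (α := V); omega
    have : Subsingleton V := Fintype.card_le_one_iff_subsingleton.1 hone.le
    let e : T.Coloring (Fin x) ≃ (V → Fin x) :=
      ⟨fun c => c, fun f => Coloring.mk f fun h => (h.ne (Subsingleton.elim _ _)).elim,
        fun _ => rfl, fun _ => rfl⟩
    rw [Nat.card_congr e, Nat.card_eq_fintype_card, Fintype.card_fun, Fintype.card_fin, hone,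
      pow_one, pow_zero, mul_one]
  | succ m ih =>
    have : Nontrivial V := Fintype.one_lt_card_iff_nontrivial.1 (by omega)
    obtain ⟨v, hv⟩ := hT.exists_vert_degree_one_of_nontrivial
    obtain ⟨u, huv, huniq⟩ := degree_eq_one_iff_existsUnique_adj.1 hv
    have hT' : (T.induce {v}ᶜ).IsTree :=
      ⟨hT.connected.induce_compl_singleton_of_degree_eq_one hv, hT.isAcyclic.induce _⟩
    have hc := ih hT' (by rw [Fintype.card_compl_set]; simp; omega)
    rw [Nat.card_congr (coloringEquivOfPendant T huv huniq)]
    let _ : Fintype ((T.induce {v}ᶜ).Coloring (Fin x)) := Fintype.ofFinite _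
    rw [Nat.card_sigma]
    simp only [Nat.card_eq_fintype_card, Fintype.card_subtype_compl, Fintype.card_subtype_eq, ne_eq,
      Fintype.card_fin, sum_const, card_univ, smul_eq_mul] at hc ⊢
    rw [hc, pow_succ, mul_assoc]

/-- A proper coloring of `G ∪ pK₁` is a proper coloring of `G` together with an arbitrary coloring
of the isolated vertices. -/
def unionIsolatedColoringEquiv {V α : Type*} (G : SimpleGraph V) (p : ℕ) :
    (unionIsolated G p).Coloring α ≃ G.Coloring α × (Fin p → α) where
  toFun c := (Coloring.mk (fun v => c (Sum.inl v)) fun {u v} huv => c.valid (by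
    simp [unionIsolated, huv, huv.ne]), fun i => c (Sum.inr i))
  invFun d := Coloring.mk (Sum.elim d.1 d.2) (by
    intro a b hab
    obtain ⟨-, ⟨u, v, rfl, rfl, h⟩ | ⟨u, v, rfl, rfl, h⟩⟩ := hab
    · exact d.1.valid h
    · exact d.1.valid h.symm)
  left_inv c := by
    ext (v | i) <;> rfl
  right_inv d := rfl

theorem hasSum_descFactorial_div_factorial (k : ℕ) :
    HasSum (fun x : ℕ => (x.descFactorial k : ℝ) / x !) (Real.exp 1) := by
  rw [← hasSum_nat_add_iff' k, Finset.sum_eq_zero, sub_zero]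
  · have h : HasSum (fun x : ℕ => (1 : ℝ) / x !) (Real.exp 1) := by
      simpa [Real.exp_eq_exp_ℝ] using NormedSpace.expSeries_div_hasSum_exp (𝔸 := ℝ) (1 : ℝ)
    refine h.congr_fun fun x => ?_
    have := Nat.factorial_mul_descFactorial (Nat.le_add_left k x)
    rw [Nat.add_sub_cancel] at this
    rw [← this]
    push_cast
    have h1 : (x ! : ℝ) ≠ 0 := by positivity
    have h2 : ((x + k).descFactorial k : ℝ) ≠ 0 := by
      rw [Nat.cast_ne_zero, Ne, Nat.descFactorial_eq_zero_iff_lt]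
      omega
    field_simp
  · intro x hx
    rw [Nat.descFactorial_of_lt (mem_range.1 hx)]
    simp

theorem hasSum_card_coloring {V : Type*} [Fintype V] [DecidableEq V] (G : SimpleGraph V) :
    HasSum (fun x : ℕ => (Nat.card (G.Coloring (Fin x)) : ℝ) / x !)
      (colB G * Real.exp 1) := by
  classical
  have h := hasSum_sum (s := univ.filter (IsStablePartition G))
    fun P _ => hasSum_descFactorial_div_factorial P.parts.card
  refine HasSum.congr_fun (Eq.subst (motive := (HasSum _ ·)) ?sum h) fun x => ?term
  case term =>
    rw [card_coloring_eq_sum_descFactorial]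
    push_cast
    rw [Finset.sum_div]
  case sum =>
    simp [colB]

theorem hasSum_sub_one_mul_card_coloring {V : Type*} [Fintype V] [DecidableEq V]
    (G : SimpleGraph V) :
    HasSum (fun x : ℕ => ((x : ℝ) - 1) * Nat.card (G.Coloring (Fin x)) / x !)
      (colT G * Real.exp 1) := by
  classical
  have h := hasSum_sum (s := univ.filter (IsStablePartition G))
    fun P _ => ((hasSum_descFactorial_div_factorial (P.parts.card + 1)).add
      ((hasSum_descFactorial_div_factorial P.parts.card).mul_left (P.parts.card : ℝ))).sub
        (hasSum_descFactorial_div_factorial P.parts.card)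
  refine HasSum.congr_fun (Eq.subst (motive := (HasSum _ ·)) ?sum h) fun x => ?term
  case term =>
    rw [card_coloring_eq_sum_descFactorial]
    push_cast
    rw [Finset.mul_sum, Finset.sum_div]
    refine Finset.sum_congr rfl fun P _ => ?_
    have : (x.descFactorial (P.parts.card + 1) : ℝ) =
        ((x : ℝ) - P.parts.card) * x.descFactorial P.parts.card := by
      rw [Nat.descFactorial_succ]
      rcases le_or_gt P.parts.card x with hx | hx
      · push_cast [hx]; rfl
      · simp [Nat.descFactorial_of_lt hx]
    rw [this]
    ring
  case sum =>
    simp [colT, Finset.sum_mul]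

/-- Dobiński's formula. -/
theorem hasSum_pow_div_factorial_bell (m : ℕ) :
    HasSum (fun x : ℕ => (x : ℝ) ^ m / x !) (bell m * Real.exp 1) := by
  have hB : colB (⊥ : SimpleGraph (Fin m)) = bell m := by
    classical
    rw [colB, bell, Finset.filter_true_of_mem fun P _ _ _ _ _ _ _ h => h, card_univ]
  have hN : ∀ x, Nat.card ((⊥ : SimpleGraph (Fin m)).Coloring (Fin x)) = x ^ m := fun x => by
    let e : (⊥ : SimpleGraph (Fin m)).Coloring (Fin x) ≃ (Fin m → Fin x) :=
      ⟨fun c => c, fun f => Coloring.mk f fun h => h.elim, fun _ => rfl, fun _ => rfl⟩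
    rw [Nat.card_congr e]
    simp
  simpa only [hB, hN, Nat.cast_pow] using hasSum_card_coloring (⊥ : SimpleGraph (Fin m))

theorem hasSum_pow_mul_succ_pow_div_factorial (m p : ℕ) :
    HasSum (fun x : ℕ => (x : ℝ) ^ m * ((x : ℝ) + 1) ^ p / x !)
      ((∑ i ∈ range (p + 1), p.choose i * bell (m + i) : ℕ) * Real.exp 1) := by
  have h := hasSum_sum (s := range (p + 1))
    fun i _ => (hasSum_pow_div_factorial_bell (m + i)).mul_left (p.choose i : ℝ)
  refine HasSum.congr_fun (Eq.subst (motive := (HasSum _ ·)) ?sum h) fun x => ?term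
  case term =>
    rw [add_pow, Finset.mul_sum, Finset.sum_div]
    refine Finset.sum_congr rfl fun i _ => ?_
    rw [one_pow, pow_add]
    ring
  case sum =>
    push_cast
    rw [Finset.sum_mul]
    exact Finset.sum_congr rfl fun i _ => by ring

theorem SimpleGraph.IsTree.card_coloring_unionIsolated_succ_div_factorial {V : Type*} [Fintype V]
    {T : SimpleGraph V} (hT : T.IsTree) (p x : ℕ) :
    (Nat.card ((unionIsolated T p).Coloring (Fin (x + 1))) : ℝ) / (x + 1)! =
      (x : ℝ) ^ (Fintype.card V - 1) * ((x : ℝ) + 1) ^ p / x ! := by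
  rw [Nat.card_congr (unionIsolatedColoringEquiv T p), Nat.card_prod, hT.card_coloring,
    Nat.factorial_succ]
  simp only [Nat.card_eq_fintype_card, Fintype.card_fun, Fintype.card_fin, Nat.add_sub_cancel]
  push_cast
  field_simp

theorem SimpleGraph.IsTree.card_coloring_unionIsolated_zero {V : Type*} [Fintype V]
    {T : SimpleGraph V} (hT : T.IsTree) (p : ℕ) :
    Nat.card ((unionIsolated T p).Coloring (Fin 0)) = 0 := by
  rw [Nat.card_congr (unionIsolatedColoringEquiv T p), Nat.card_prod, hT.card_coloring]
  simp

/-- For a tree `T` of order `n ≥ 1` and `p ≥ 0`,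
`B(T ∪ pK₁) = ∑ C(p,i) bell (n+i-1)` and `T(T ∪ pK₁) = ∑ C(p,i) bell (n+i)`. -/
theorem stmt_2 {V : Type*} [Fintype V] [DecidableEq V] (T : SimpleGraph V) (n p : ℕ)
    (hn : 1 ≤ n) (hcard : Fintype.card V = n) (hT : T.IsTree) :
    colB (unionIsolated T p) = ∑ i ∈ Finset.range (p + 1), p.choose i * bell (n + i - 1) ∧
    colT (unionIsolated T p) = ∑ i ∈ Finset.range (p + 1), p.choose i * bell (n + i) := by
  have he : Real.exp 1 ≠ 0 := (Real.exp_pos 1).ne'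
  have hshift : ∀ i, n + i - 1 = n - 1 + i := fun i => by omega
  constructor
  · have h := (hasSum_nat_add_iff' 1).2 (hasSum_card_coloring (unionIsolated T p))
    simp only [hT.card_coloring_unionIsolated_succ_div_factorial, hcard, range_one,
      sum_singleton, hT.card_coloring_unionIsolated_zero, Nat.cast_zero, zero_div,
      sub_zero] at h
    simp only [hshift]
    exact_mod_cast mul_right_cancel₀ he
      (h.unique (hasSum_pow_mul_succ_pow_div_factorial (n - 1) p))
  · have h := (hasSum_nat_add_iff' 1).2 (hasSum_sub_one_mul_card_coloring (unionIsolated T p))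
    simp only [mul_div_assoc, hT.card_coloring_unionIsolated_succ_div_factorial, hcard,
      range_one, sum_singleton, hT.card_coloring_unionIsolated_zero, Nat.cast_zero,
      zero_div, mul_zero, sub_zero] at h
    refine Nat.cast_injective (R := ℝ) (mul_right_cancel₀ he (h.unique ?_))
    refine (hasSum_pow_mul_succ_pow_div_factorial n p).congr_fun fun x => ?_
    obtain ⟨k, rfl⟩ := Nat.exists_eq_add_of_le' hn
    rw [Nat.add_sub_cancel, pow_succ]
    push_cast
    ring
end

section
/- Let n ≥ 3 and p ≥ 0, and let C_n ∪ pK_1 be the graph obtained from the cycle of order n by adding p isolated vertices. Then B(C_n ∪ pK_1) = Σ_{j=1}^{n−1} (−1)^{j+1} Σ_{i=0}^{p} C(p,i) B_{n+i−j} and T(C_n ∪ pK_1) = Σ_{j=1}^{n−1} (−1)^{j+1} Σ_{i=0}^{p} C(p,i) B_{n+i−j+1}, where C(p,i) is the binomial coefficient and B_k is the k-th Bell number (the equalities hold as integers). -/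
open Finset SimpleGraph

section KernelPartition

variable {V : Type*} [Fintype V] [DecidableEq V]

/-- The partition of `V` into the nonempty fibres of `f`. -/
def kerPartition {k : ℕ} (f : V → Fin k) : Finpartition (univ : Finset V) :=
  haveI : DecidableRel (Setoid.ker f).r := fun a b => inferInstanceAs (Decidable (f a = f b))
  Finpartition.ofSetoid (Setoid.ker f)

lemma mem_part_kerPartition {k : ℕ} (f : V → Fin k) (u v : V) :
    v ∈ (kerPartition f).part u ↔ f u = f v := by
  let _ : DecidableRel (Setoid.ker f).r := fun a b => inferInstanceAs (Decidable (f a = f b))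
  exact Finpartition.mem_part_ofSetoid_iff_rel

lemma finpartition_eq_of_part_eq {P Q : Finpartition (univ : Finset V)}
    (h : ∀ u, P.part u = Q.part u) : P = Q := by
  have key : ∀ P Q : Finpartition (univ : Finset V), (∀ u, P.part u = Q.part u) →
      P.parts ⊆ Q.parts := by
    intro P Q h t ht
    obtain ⟨x, hx⟩ := P.nonempty_of_mem_parts ht
    rw [← P.part_eq_of_mem ht hx, h]
    exact Q.part_mem.2 (mem_univ _)
  exact Finpartition.ext (Subset.antisymm (key P Q h) (key Q P fun u => (h u).symm))

lemma kerPartition_eq_iff {k : ℕ} (f : V → Fin k) (P : Finpartition (univ : Finset V)) :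
    kerPartition f = P ↔ ∀ u v, v ∈ P.part u ↔ f u = f v := by
  refine ⟨?_, fun h => finpartition_eq_of_part_eq fun u => ?_⟩
  · rintro rfl u v
    exact mem_part_kerPartition f u v
  · ext v
    rw [mem_part_kerPartition, h]

lemma card_filter_kerPartition_eq (k : ℕ) (P : Finpartition (univ : Finset V)) :
    #{f : V → Fin k | kerPartition f = P} = k.descFactorial #P.parts := by
  have hcard : Fintype.card (P.parts ↪ Fin k) = k.descFactorial #P.parts := by
    simp [Fintype.card_embedding_eq]
  rw [← hcard, ← Finset.card_univ]
  symm
  have hp : ∀ v, P.part v ∈ P.parts := fun v => P.part_mem.2 (mem_univ v)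
  refine Finset.card_bij (fun e _ v => e ⟨P.part v, hp v⟩) ?_ ?_ ?_
  · intro e _
    simp only [mem_filter, mem_univ, true_and, kerPartition_eq_iff]
    intro u v
    rw [P.mem_part_iff_part_eq_part (mem_univ v) (mem_univ u), e.injective.eq_iff,
      Subtype.mk.injEq, eq_comm]
  · intro e _ e' _ h
    ext ⟨t, ht⟩
    obtain ⟨x, hx⟩ := P.nonempty_of_mem_parts ht
    have := congrFun h x
    simp only [P.part_eq_of_mem ht hx] at this
    rw [this]
  · intro f hf
    simp only [mem_filter, mem_univ, true_and, kerPartition_eq_iff] at hf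
    choose r hr using fun t : P.parts => P.nonempty_of_mem_parts t.2
    refine ⟨⟨fun t => f (r t), fun s t hst => ?_⟩, mem_univ _, ?_⟩
    · have h1 := (hf _ _).2 hst
      rw [P.part_eq_of_mem s.2 (hr s)] at h1
      exact Subtype.ext (P.eq_of_mem_parts s.2 t.2 h1 (hr t))
    · funext v
      exact ((hf _ _).1 (hr ⟨P.part v, hp v⟩)).symm

lemma isStablePartition_kerPartition_iff (G : SimpleGraph V) {k : ℕ} (f : V → Fin k) :
    IsStablePartition G (kerPartition f) ↔ ∀ u v, G.Adj u v → f u ≠ f v := by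
  constructor
  · intro h u v huv hf
    exact h _ ((kerPartition f).part_mem.2 (mem_univ u)) u
      ((mem_part_kerPartition f u u).2 rfl) v ((mem_part_kerPartition f u v).2 hf) huv
  · intro h t ht u hu v hv huv
    rw [← (kerPartition f).part_eq_of_mem ht hu, mem_part_kerPartition] at hv
    exact h u v huv hv

open scoped Classical in
/-- The number of proper colorings of `G` with `k` colors. -/
noncomputable def properCount (G : SimpleGraph V) (k : ℕ) : ℕ :=
  #{f : V → Fin k | ∀ u v, G.Adj u v → f u ≠ f v}

open scoped Classical in
lemma properCount_eq_sum (G : SimpleGraph V) (k : ℕ) :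
    properCount G k = ∑ P with IsStablePartition G P, k.descFactorial #P.parts := by
  rw [properCount, Finset.card_eq_sum_card_fiberwise (f := kerPartition)
    (t := univ.filter (IsStablePartition G))]
  · refine Finset.sum_congr rfl fun P hP => ?_
    rw [← card_filter_kerPartition_eq, filter_filter]
    congr 1
    ext f
    simp only [mem_filter, mem_univ, true_and] at hP ⊢
    refine ⟨fun h => h.2, fun h => ⟨?_, h⟩⟩
    rw [← isStablePartition_kerPartition_iff, h]
    exact hP
  · intro f hf
    simpa [isStablePartition_kerPartition_iff] using hf

end KernelPartition

lemma linearIndependent_descFactorial :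
    LinearIndependent ℚ fun (r k : ℕ) => (k.descFactorial r : ℚ) := by
  rw [linearIndependent_iff']
  intro s g hg r
  induction r using Nat.strong_induction_on with
  | _ r ih =>
    intro hr
    have h := congrFun hg r
    simp only [Finset.sum_apply, Pi.smul_apply, smul_eq_mul, Pi.zero_apply] at h
    rw [Finset.sum_eq_single_of_mem r hr] at h
    · simpa [Nat.descFactorial_self, Nat.factorial_ne_zero] using h
    · intro t ht htr
      rcases lt_or_gt_of_ne htr with hlt | hlt
      · rw [ih t hlt ht, zero_mul]
      · rw [Nat.descFactorial_of_lt hlt, Nat.cast_zero, mul_zero]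

/-- There is a linear functional sending every falling factorial to `1`. -/
lemma exists_bellFunctional :
    ∃ L : (ℕ → ℚ) →ₗ[ℚ] ℚ, ∀ r, L (fun k => (k.descFactorial r : ℚ)) = 1 := by
  have hli := linearIndependent_descFactorial
  obtain ⟨L, hL⟩ := LinearMap.exists_extend ((Module.Basis.span hli).constr ℚ fun _ => (1 : ℚ))
  refine ⟨L, fun r => ?_⟩
  have h := LinearMap.congr_fun hL (Module.Basis.span hli r)
  rw [Module.Basis.constr_basis] at h
  simpa [Module.Basis.span_apply] using h

section Functional

variable {L : (ℕ → ℚ) →ₗ[ℚ] ℚ}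

lemma bellFunctional_sum
    (hL : ∀ r, L (fun k => (k.descFactorial r : ℚ)) = 1)
    {ι : Type*} (s : Finset ι) (r : ι → ℕ) (a : ι → ℚ) :
    L (fun k => ∑ i ∈ s, a i * (k.descFactorial (r i) : ℚ)) = ∑ i ∈ s, a i := by
  have : (fun k : ℕ => ∑ i ∈ s, a i * (k.descFactorial (r i) : ℚ)) =
      ∑ i ∈ s, a i • fun k : ℕ => (k.descFactorial (r i) : ℚ) := by
    ext k
    simp
  rw [this, map_sum]
  simp [hL]

lemma bellFunctional_properCount
    (hL : ∀ r, L (fun k => (k.descFactorial r : ℚ)) = 1)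
    {V : Type*} [Fintype V] [DecidableEq V] (G : SimpleGraph V) :
    L (fun k => (properCount G k : ℚ)) = colB G := by
  classical
  have := bellFunctional_sum hL (univ.filter (IsStablePartition G)) (fun P => #P.parts)
    (fun _ => 1)
  simpa [properCount_eq_sum, colB] using this

lemma natCast_sub_one_mul_descFactorial (k r : ℕ) :
    ((k : ℚ) - 1) * k.descFactorial r =
      1 * k.descFactorial (r + 1) + ((r : ℚ) - 1) * k.descFactorial r := by
  rw [Nat.descFactorial_succ]
  rcases le_or_gt r k with h | h
  · push_cast [h]
    ring
  · simp [Nat.descFactorial_of_lt h]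

lemma bellFunctional_sub_one_mul_properCount
    (hL : ∀ r, L (fun k => (k.descFactorial r : ℚ)) = 1)
    {V : Type*} [Fintype V] [DecidableEq V]
    (G : SimpleGraph V) :
    L (fun k => ((k : ℚ) - 1) * (properCount G k : ℚ)) = colT G := by
  classical
  set S := univ.filter (IsStablePartition G)
  have h1 := bellFunctional_sum hL S (fun P => #P.parts + 1) (fun _ => 1)
  have h2 := bellFunctional_sum hL S (fun P => #P.parts) (fun P => (#P.parts : ℚ) - 1)
  have h : (fun k : ℕ => ((k : ℚ) - 1) * (properCount G k : ℚ)) =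
      (fun k : ℕ => ∑ P ∈ S, 1 * (k.descFactorial (#P.parts + 1) : ℚ)) +
      (fun k : ℕ => ∑ P ∈ S, ((#P.parts : ℚ) - 1) * (k.descFactorial #P.parts : ℚ)) := by
    ext k
    rw [Pi.add_apply, ← Finset.sum_add_distrib, properCount_eq_sum]
    push_cast
    rw [Finset.mul_sum]
    exact Finset.sum_congr rfl fun P _ => natCast_sub_one_mul_descFactorial k _
  rw [h, map_add, h1, h2, ← Finset.sum_add_distrib, colT]
  push_cast
  exact Finset.sum_congr rfl fun P _ => by ring

lemma pow_eq_sum_descFactorial (k m : ℕ) :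
    k ^ m = ∑ P : Finpartition (univ : Finset (Fin m)), k.descFactorial #P.parts := by
  classical
  have h := properCount_eq_sum (⊥ : SimpleGraph (Fin m)) k
  simpa [properCount, IsStablePartition] using h

lemma bellFunctional_mul_sub_one_pow
    (hL : ∀ r, L (fun k => (k.descFactorial r : ℚ)) = 1)
    (m : ℕ) :
    L (fun k => (k : ℚ) * ((k : ℚ) - 1) ^ m) = bell m := by
  have h1 := bellFunctional_sum hL (univ : Finset (Finpartition (univ : Finset (Fin m))))
    (fun P => #P.parts + 1) (fun _ => 1)
  have h : (fun k : ℕ => (k : ℚ) * ((k : ℚ) - 1) ^ m) = fun k : ℕ =>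
      ∑ P : Finpartition (univ : Finset (Fin m)), 1 * (k.descFactorial (#P.parts + 1) : ℚ) := by
    ext k
    cases k with
    | zero => simp
    | succ k =>
      simp only [Nat.succ_descFactorial_succ]
      push_cast
      simp only [one_mul, add_sub_cancel_right]
      rw [← Finset.mul_sum]
      congr 1
      exact_mod_cast pow_eq_sum_descFactorial k m
  rw [h, h1]
  simp [bell]

lemma bellFunctional_alternating_sum
    (hL : ∀ r, L (fun k => (k.descFactorial r : ℚ)) = 1)
    (n p : ℕ) (e : ℕ → ℕ → ℕ) :
    L (fun k => ∑ j ∈ Icc 1 (n - 1), (-1 : ℚ) ^ (j + 1) * ∑ i ∈ range (p + 1),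
      (p.choose i : ℚ) * ((k : ℚ) * ((k : ℚ) - 1) ^ e i j)) =
    ∑ j ∈ Icc 1 (n - 1), (-1 : ℚ) ^ (j + 1) * ∑ i ∈ range (p + 1),
      (p.choose i : ℚ) * bell (e i j) := by
  have h : (fun k : ℕ => ∑ j ∈ Icc 1 (n - 1), (-1 : ℚ) ^ (j + 1) * ∑ i ∈ range (p + 1),
      (p.choose i : ℚ) * ((k : ℚ) * ((k : ℚ) - 1) ^ e i j)) =
      ∑ j ∈ Icc 1 (n - 1), (-1 : ℚ) ^ (j + 1) • ∑ i ∈ range (p + 1),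
      (p.choose i : ℚ) • fun k : ℕ => ((k : ℚ) * ((k : ℚ) - 1) ^ e i j) := by
    ext k
    simp
  rw [h]
  simp [bellFunctional_mul_sub_one_pow hL]

end Functional

section CycleColorings

/-- Sequences of `n + 1` colors in which consecutive colors differ. -/
def pathColorings (k n : ℕ) : Finset (Fin (n + 1) → Fin k) :=
  {f | ∀ i : Fin n, f i.castSucc ≠ f i.succ}

lemma snoc_mem_pathColorings {k n : ℕ} (g : Fin (n + 1) → Fin k) (x : Fin k) :
    (Fin.snoc g x : Fin (n + 2) → Fin k) ∈ pathColorings k (n + 1) ↔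
      g ∈ pathColorings k n ∧ g (Fin.last n) ≠ x := by
  simp only [pathColorings, mem_filter, mem_univ, true_and]
  rw [Fin.forall_fin_succ']
  simp only [Fin.snoc_castSucc, Fin.succ_last, Fin.snoc_last, Fin.succ_castSucc]

lemma card_pathColorings_succ (k n : ℕ) :
    #(pathColorings k (n + 1)) = (k - 1) * #(pathColorings k n) := by
  have : #(pathColorings k (n + 1)) =
      #((pathColorings k n).sigma fun g => univ.erase (g (Fin.last n))) := by
    symm
    refine Finset.card_bij (fun a _ => Fin.snoc a.1 a.2) ?_ ?_ ?_
    · rintro ⟨g, x⟩ h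
      simp only [mem_sigma, mem_erase, mem_univ, and_true] at h
      exact (snoc_mem_pathColorings g x).2 ⟨h.1, h.2.symm⟩
    · rintro ⟨g, x⟩ _ ⟨g', x'⟩ _ h
      obtain ⟨rfl, rfl⟩ := Fin.snoc_inj.1 h
      rfl
    · intro f hf
      rw [← Fin.snoc_init_self f, snoc_mem_pathColorings] at hf
      exact ⟨⟨Fin.init f, f (Fin.last _)⟩, by simpa [eq_comm] using hf, Fin.snoc_init_self f⟩
  rw [this, Finset.card_sigma]
  simp [mul_comm]

lemma card_pathColorings_closed_succ (k n : ℕ) :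
    #{f ∈ pathColorings k (n + 1) | f (Fin.last _) = f 0} =
      #{f ∈ pathColorings k n | f (Fin.last _) ≠ f 0} := by
  symm
  have h0 : ∀ (g : Fin (n + 1) → Fin k) (x : Fin k),
      (Fin.snoc g x : Fin (n + 2) → Fin k) 0 = g 0 := fun g x => by
    rw [← Fin.castSucc_zero, Fin.snoc_castSucc]
  refine Finset.card_bij (fun g _ => Fin.snoc g (g 0)) ?_ ?_ ?_
  · intro g hg
    rw [mem_filter] at hg
    rw [mem_filter, snoc_mem_pathColorings, Fin.snoc_last, h0]
    exact ⟨hg, rfl⟩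
  · intro g _ g' _ h
    exact (Fin.snoc_inj.1 h).1
  · intro f hf
    rw [← Fin.snoc_init_self f, mem_filter, snoc_mem_pathColorings, Fin.snoc_last, h0] at hf
    refine ⟨Fin.init f, ?_, ?_⟩
    · rw [mem_filter, ← hf.2]
      exact hf.1
    · rw [← hf.2, Fin.snoc_init_self]

lemma card_pathColorings (k n : ℕ) : (#(pathColorings k n) : ℚ) = k * ((k : ℚ) - 1) ^ n := by
  induction n with
  | zero => simp [pathColorings]
  | succ n ih =>
    rw [card_pathColorings_succ, Nat.cast_mul, ih]
    cases k with
    | zero => simp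
    | succ k => push_cast; simp; ring

lemma card_pathColorings_open (k n : ℕ) :
    (#{f ∈ pathColorings k n | f (Fin.last _) ≠ f 0} : ℚ) =
      ((k : ℚ) - 1) ^ (n + 1) + (-1) ^ (n + 1) * ((k : ℚ) - 1) := by
  induction n with
  | zero => simp
  | succ n ih =>
    have h := Finset.card_filter_add_card_filter_not (s := pathColorings k (n + 1))
      (fun f => f (Fin.last _) = f 0)
    rw [card_pathColorings_closed_succ] at h
    have h' := congrArg (Nat.cast : ℕ → ℚ) h
    rw [Nat.cast_add, ih, card_pathColorings] at h'
    rw [eq_sub_of_add_eq' h']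
    ring

lemma forall_cycleGraph_adj_ne_iff {k n : ℕ} (f : Fin (n + 2) → Fin k) :
    (∀ u v, (cycleGraph (n + 2)).Adj u v → f u ≠ f v) ↔
      f ∈ pathColorings k (n + 1) ∧ f (Fin.last _) ≠ f 0 := by
  have h1 : (∀ u v, (cycleGraph (n + 2)).Adj u v → f u ≠ f v) ↔ ∀ u, f u ≠ f (u + 1) := by
    simp only [cycleGraph_adj]
    constructor
    · intro h u
      exact h u (u + 1) (Or.inr (by simp))
    · rintro h u v (huv | huv)
      · rw [sub_eq_iff_eq_add'.1 huv]
        exact (h v).symm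
      · rw [sub_eq_iff_eq_add'.1 huv]
        exact h u
  rw [h1, Fin.forall_fin_succ', pathColorings, mem_filter]
  simp [Fin.coeSucc_eq_succ]

lemma properCount_cycleGraph (k n : ℕ) (hn : 2 ≤ n) :
    (properCount (cycleGraph n) k : ℚ) = ((k : ℚ) - 1) ^ n + (-1) ^ n * ((k : ℚ) - 1) := by
  obtain ⟨n, rfl⟩ := Nat.exists_eq_add_of_le' hn
  rw [← card_pathColorings_open, properCount]
  congr 2
  ext f
  simp [forall_cycleGraph_adj_ne_iff]

end CycleColorings

lemma properCount_unionIsolated {V : Type*} [Fintype V] [DecidableEq V] (G : SimpleGraph V)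
    (p k : ℕ) : properCount (unionIsolated G p) k = properCount G k * k ^ p := by
  classical
  have h : k ^ p = #(univ : Finset (Fin p → Fin k)) := by simp
  rw [properCount, properCount, h, ← Finset.card_product]
  refine Finset.card_equiv (Equiv.sumArrowEquivProdArrow V (Fin p) (Fin k)) fun f => ?_
  simp only [mem_filter, mem_univ, true_and, mem_product, and_true]
  constructor
  · intro hf u v huv
    exact hf _ _ (by simpa [unionIsolated, G.adj_comm v u] using ⟨huv.ne, huv⟩)
  · intro hf u v huv
    rw [unionIsolated, fromRel_adj] at huv
    obtain ⟨-, ⟨a, b, rfl, rfl, hab⟩ | ⟨a, b, rfl, rfl, hab⟩⟩ := huv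
    · exact hf a b hab
    · exact (hf a b hab).symm

lemma sum_choose_mul_pow_add (x : ℚ) (p m : ℕ) :
    ∑ i ∈ range (p + 1), (p.choose i : ℚ) * ((x + 1) * x ^ (m + i)) =
      (x + 1) ^ p * ((x + 1) * x ^ m) := by
  rw [add_pow, Finset.sum_mul]
  exact Finset.sum_congr rfl fun i _ => by rw [one_pow, pow_add]; ring

lemma alternating_geom_sum (x : ℚ) (n : ℕ) (hn : 1 ≤ n) :
    ∑ j ∈ Icc 1 (n - 1), (-1 : ℚ) ^ (j + 1) * ((x + 1) * x ^ (n - j)) =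
      x ^ n + (-1) ^ n * x := by
  obtain ⟨n, rfl⟩ := Nat.exists_eq_add_of_le' hn
  rw [Nat.add_sub_cancel]
  have key : ∀ m ≤ n, ∑ j ∈ Icc 1 m, (-1 : ℚ) ^ (j + 1) * ((x + 1) * x ^ (n + 1 - j)) =
      x ^ (n + 1) - (-1) ^ m * x ^ (n + 1 - m) := by
    intro m hm
    induction m with
    | zero => simp
    | succ m ih =>
      rw [Finset.sum_Icc_succ_top (by lia), ih (by lia),
        show n + 1 - m = (n + 1 - (m + 1)) + 1 by lia]
      ring
  rw [key n le_rfl, Nat.add_sub_cancel_left]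
  ring

lemma properCount_cycle_unionIsolated (n p k c : ℕ) (hn : 2 ≤ n) :
    ((k : ℚ) - 1) ^ c * (properCount (unionIsolated (cycleGraph n) p) k : ℚ) =
      ∑ j ∈ Icc 1 (n - 1), (-1 : ℚ) ^ (j + 1) * ∑ i ∈ range (p + 1),
        (p.choose i : ℚ) * ((k : ℚ) * ((k : ℚ) - 1) ^ (n + i - j + c)) := by
  rw [properCount_unionIsolated, Nat.cast_mul, properCount_cycleGraph k n hn,
    ← alternating_geom_sum _ n (by lia), Nat.cast_pow, Finset.sum_mul, Finset.mul_sum]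
  refine Finset.sum_congr rfl fun j hj => ?_
  rw [mem_Icc] at hj
  have h := sum_choose_mul_pow_add ((k : ℚ) - 1) p (n - j + c)
  rw [sub_add_cancel] at h ⊢
  have h' : ∀ i, n + i - j + c = n - j + c + i := fun i => by lia
  simp only [h']
  rw [h, pow_add]
  ring

/-- For `n ≥ 3` and `p ≥ 0`,
`B(C_n ∪ pK₁) = ∑_{j=1}^{n-1} (-1)^{j+1} ∑_{i=0}^p C(p,i) bell (n+i-j)` and
`T(C_n ∪ pK₁) = ∑_{j=1}^{n-1} (-1)^{j+1} ∑_{i=0}^p C(p,i) bell (n+i-j+1)`. -/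
theorem stmt_4 (n p : ℕ) (hn : 3 ≤ n) :
    (colB (unionIsolated (cycleGraph n) p) : ℤ) =
      ∑ j ∈ Finset.Icc 1 (n - 1), (-1 : ℤ) ^ (j + 1) *
        ∑ i ∈ Finset.range (p + 1), p.choose i * bell (n + i - j) ∧
    (colT (unionIsolated (cycleGraph n) p) : ℤ) =
      ∑ j ∈ Finset.Icc 1 (n - 1), (-1 : ℤ) ^ (j + 1) *
        ∑ i ∈ Finset.range (p + 1), p.choose i * bell (n + i - j + 1) := by
  obtain ⟨L, hL⟩ := exists_bellFunctional
  constructor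
  · have h := bellFunctional_properCount hL (unionIsolated (cycleGraph n) p)
    have hc := fun k => properCount_cycle_unionIsolated n p k 0 (by lia)
    simp only [pow_zero, one_mul, add_zero] at hc
    simp only [hc] at h
    rw [bellFunctional_alternating_sum hL n p fun i j => n + i - j] at h
    exact_mod_cast h.symm
  · have h := bellFunctional_sub_one_mul_properCount hL (unionIsolated (cycleGraph n) p)
    have hc := fun k => properCount_cycle_unionIsolated n p k 1 (by lia)
    simp only [pow_one] at hc
    simp only [hc] at h
    rw [bellFunctional_alternating_sum hL n p fun i j => n + i - j + 1] at h
    exact_mod_cast h.symm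
end

section
/- For all n ≥ 4 and p ≥ 0, A(H_{3,n−3} ∪ pK_1) < A(P_{n+1} ∪ pK_1). -/
open Finset SimpleGraph

section PoissonFunctional

open Polynomial

/-- `factorialSum f = ∑ k, f(k) / k!`, that is, `e` times the mean of `f` under the Poisson
distribution of parameter `1`. -/
noncomputable def factorialSum (f : ℝ[X]) : ℝ :=
  ∑' k : ℕ, f.eval (k : ℝ) / (k.factorial : ℝ)

lemma summable_pow_index_div_factorial (m : ℕ) :
    Summable fun k : ℕ => (k : ℝ) ^ m / (k.factorial : ℝ) := by
  have h := (Real.summable_pow_div_factorial (Real.exp 1)).mul_left (m.factorial : ℝ)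
  refine Summable.of_nonneg_of_le (fun k => by positivity) (fun k => ?_) h
  have h1 : (k : ℝ) ^ m / (m.factorial : ℝ) ≤ Real.exp 1 ^ k := by
    rw [← Real.exp_nat_mul, mul_one]
    exact Real.pow_div_factorial_le_exp _ (Nat.cast_nonneg k) m
  rw [div_le_iff₀ (by positivity)] at h1
  rw [← mul_div_assoc]
  gcongr
  linarith

lemma summable_eval_div_factorial (f : ℝ[X]) :
    Summable fun k : ℕ => f.eval (k : ℝ) / (k.factorial : ℝ) := by
  induction f using Polynomial.induction_on' with
  | add f g hf hg => simpa [add_div] using hf.add hg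
  | monomial m a =>
    simpa [mul_div_assoc] using (summable_pow_index_div_factorial m).mul_left a

lemma factorialSum_add (f g : ℝ[X]) :
    factorialSum (f + g) = factorialSum f + factorialSum g := by
  simp only [factorialSum, eval_add, add_div]
  exact (summable_eval_div_factorial f).tsum_add (summable_eval_div_factorial g)

lemma factorialSum_C_mul (a : ℝ) (f : ℝ[X]) :
    factorialSum (C a * f) = a * factorialSum f := by
  simp only [factorialSum, eval_mul, eval_C, mul_div_assoc]
  exact tsum_mul_left

lemma factorialSum_congr {f g : ℝ[X]} (h : ∀ k : ℕ, f.eval (k : ℝ) = g.eval (k : ℝ)) :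
    factorialSum f = factorialSum g := by
  simp only [factorialSum, h]

lemma factorialSum_sum {ι : Type*} (s : Finset ι) (f : ι → ℝ[X]) :
    factorialSum (∑ i ∈ s, f i) = ∑ i ∈ s, factorialSum (f i) := by
  classical
  induction s using Finset.induction_on with
  | empty => simp [factorialSum]
  | insert i s hi ih => rw [sum_insert hi, sum_insert hi, factorialSum_add, ih]

lemma factorialSum_one : factorialSum 1 = Real.exp 1 := by
  rw [Real.exp_eq_exp_ℝ, NormedSpace.exp_eq_tsum_div]
  simp [factorialSum]

lemma factorialSum_mono {f g : ℝ[X]} (h : ∀ k : ℕ, f.eval (k : ℝ) ≤ g.eval (k : ℝ)) :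
    factorialSum f ≤ factorialSum g :=
  (summable_eval_div_factorial f).tsum_le_tsum
    (fun k => by gcongr; exact h k) (summable_eval_div_factorial g)

lemma factorialSum_pos {f : ℝ[X]} (h : ∀ k : ℕ, 0 ≤ f.eval (k : ℝ)) (j : ℕ)
    (hj : 0 < f.eval (j : ℝ)) : 0 < factorialSum f :=
  (summable_eval_div_factorial f).tsum_pos (fun k => div_nonneg (h k) (by positivity)) j
    (div_pos hj (by positivity))

lemma factorialSum_lt {f g : ℝ[X]} (h : ∀ k : ℕ, f.eval (k : ℝ) < g.eval (k : ℝ)) :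
    factorialSum f < factorialSum g := by
  have hpos : 0 < factorialSum (g + C (-1) * f) :=
    factorialSum_pos (fun k => by simpa using (h k).le) 0 (by simpa using h 0)
  rw [factorialSum_add, factorialSum_C_mul] at hpos
  linarith

lemma factorialSum_X_mul (f : ℝ[X]) :
    factorialSum (X * f) = factorialSum (f.comp (X + 1)) := by
  unfold factorialSum
  rw [(summable_eval_div_factorial (X * f)).tsum_eq_zero_add]
  simp only [eval_mul, eval_X, Nat.cast_zero, zero_mul, zero_div, zero_add]
  refine tsum_congr fun k => ?_
  have hk : ((k : ℝ) + 1) ≠ 0 := by positivity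
  simp only [eval_comp, eval_add, eval_X, eval_one, Nat.factorial_succ, Nat.cast_mul,
    Nat.cast_add, Nat.cast_one]
  rw [mul_div_mul_left _ _ hk]

lemma factorialSum_descPochhammer (k : ℕ) :
    factorialSum (descPochhammer ℝ k) = Real.exp 1 := by
  induction k with
  | zero => rw [descPochhammer_zero, factorialSum_one]
  | succ k ih =>
    rw [descPochhammer_succ_left, factorialSum_X_mul, comp_assoc]
    simpa using ih

lemma factorialSum_X_mul_descPochhammer (k : ℕ) :
    factorialSum (X * descPochhammer ℝ k) = (k + 1) * Real.exp 1 := by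
  have h : X * descPochhammer ℝ k =
      descPochhammer ℝ (k + 1) + C (k : ℝ) * descPochhammer ℝ k := by
    rw [descPochhammer_succ_right, map_natCast]
    ring
  rw [h, factorialSum_add, factorialSum_C_mul, factorialSum_descPochhammer,
    factorialSum_descPochhammer]
  ring

/-- The unnormalised variance `n₀n₂ - n₁²` strictly increases when the weight does. -/
lemma variance_lt_of_weight_lt {φ ψ : ℝ[X]} (hφ : ∀ k : ℕ, 0 < φ.eval (k : ℝ))
    (h : ∀ k : ℕ, φ.eval (k : ℝ) < ψ.eval (k : ℝ)) :
    factorialSum φ * factorialSum (φ * X ^ 2) - factorialSum (φ * X) ^ 2 <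
      factorialSum ψ * factorialSum (ψ * X ^ 2) - factorialSum (ψ * X) ^ 2 := by
  have key : ∀ (c : ℝ) (χ : ℝ[X]), factorialSum (χ * (X - C c) ^ 2) =
      factorialSum (χ * X ^ 2) - 2 * c * factorialSum (χ * X) + c ^ 2 * factorialSum χ := by
    intro c χ
    have : χ * (X - C c) ^ 2 = χ * X ^ 2 + C (-2 * c) * (χ * X) + C (c ^ 2) * χ := by
      simp only [map_mul, map_neg, map_pow, map_ofNat]
      ring
    rw [this, factorialSum_add, factorialSum_add, factorialSum_C_mul, factorialSum_C_mul]
    ring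
  have hφ0 : 0 < factorialSum φ := factorialSum_pos (fun k => (hφ k).le) 0 (hφ 0)
  have hlt : factorialSum φ < factorialSum ψ := factorialSum_lt h
  have hψ0 := hφ0.trans hlt
  set c : ℝ := factorialSum (ψ * X) / factorialSum ψ with hc
  have hcψ : factorialSum (ψ * X) = c * factorialSum ψ := by
    rw [hc, div_mul_cancel₀ _ hψ0.ne']
  have hle : factorialSum (φ * (X - C c) ^ 2) ≤ factorialSum (ψ * (X - C c) ^ 2) := by
    refine factorialSum_mono fun k => ?_
    simp only [eval_mul, eval_pow]
    exact mul_le_mul_of_nonneg_right (h k).le (sq_nonneg _)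
  have hpos : 0 < factorialSum (ψ * (X - C c) ^ 2) := by
    have hψ : ∀ k : ℕ, 0 < ψ.eval (k : ℝ) := fun k => (hφ k).trans (h k)
    have hnonneg : ∀ k : ℕ, 0 ≤ (ψ * (X - C c) ^ 2).eval (k : ℝ) := fun k => by
      simp only [eval_mul, eval_pow]
      exact mul_nonneg (hψ k).le (sq_nonneg _)
    obtain ⟨j, hj⟩ : ∃ j : ℕ, (j : ℝ) - c ≠ 0 := by
      by_cases h0 : c = 0
      · exact ⟨1, by simp [h0]⟩
      · exact ⟨0, by simpa using h0⟩
    refine factorialSum_pos hnonneg j ?_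
    simp only [eval_mul, eval_pow, eval_sub, eval_X, eval_C]
    exact mul_pos (hψ j) (by positivity)
  have h1 := mul_lt_mul_of_pos_right hlt hpos
  have h2 := mul_le_mul_of_nonneg_left hle hφ0.le
  have h3 := h2.trans_lt h1
  rw [key, key, hcψ] at h3
  rw [hcψ]
  nlinarith [sq_nonneg (factorialSum (φ * X) - c * factorialSum φ)]

lemma factorialSum_ratio_lt (p q : ℕ) :
    factorialSum (X * (X * (X - 1) ^ (q + 2) * (X - 2) * X ^ p)) /
        factorialSum (X * (X - 1) ^ (q + 2) * (X - 2) * X ^ p) <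
      factorialSum (X * (X * (X - 1) ^ (q + 4) * X ^ p)) /
        factorialSum (X * (X - 1) ^ (q + 4) * X ^ p) := by
  set φ : ℝ[X] := (X + 2) ^ p * (X + 1) ^ (q + 1) with hφdef
  set ψ : ℝ[X] := φ.comp (X + 1) with hψdef
  have shift : ∀ f : ℝ[X], factorialSum (X * (X - 1) * f) = factorialSum (f.comp (X + 2)) := by
    intro f
    rw [mul_assoc, factorialSum_X_mul, mul_comp, sub_comp, X_comp, one_comp, add_sub_cancel_right,
      factorialSum_X_mul, comp_assoc]
    congr 2
    simp only [add_comp, X_comp, one_comp]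
    ring
  have two_comp : ∀ r : ℝ[X], (2 : ℝ[X]).comp r = 2 := fun r => ofNat_comp 2
  have hφ : ∀ k : ℕ, 0 < φ.eval (k : ℝ) := fun k => by
    simp only [hφdef, eval_mul, eval_pow, eval_add, eval_X, eval_one, eval_ofNat]
    positivity
  have hlt : ∀ k : ℕ, φ.eval (k : ℝ) < ψ.eval (k : ℝ) := fun k => by
    simp only [hψdef, hφdef, eval_comp, eval_mul, eval_pow, eval_add, eval_X, eval_one, eval_ofNat]
    refine mul_lt_mul' ?_ ?_ (by positivity) (by positivity)
    · gcongr; linarith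
    · gcongr; linarith
  have hvar := variance_lt_of_weight_lt hφ hlt
  have hm1 : factorialSum (φ * X) = factorialSum ψ := by
    rw [mul_comm, factorialSum_X_mul]
  have hm2 : factorialSum (φ * X ^ 2) = factorialSum (ψ * X) + factorialSum ψ := by
    rw [show φ * X ^ 2 = X * (φ * X) by ring, factorialSum_X_mul, ← factorialSum_add]
    congr 1
    simp only [mul_comp, X_comp]
    ring
  have hm3 : factorialSum (φ * X ^ 3) =
      factorialSum (ψ * X ^ 2) + 2 * factorialSum (ψ * X) + factorialSum ψ := by
    rw [show φ * X ^ 3 = X * (φ * X ^ 2) by ring, factorialSum_X_mul, ← factorialSum_C_mul,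
      ← factorialSum_add, ← factorialSum_add]
    congr 1
    simp only [mul_comp, X_comp, pow_comp, map_ofNat]
    ring
  have e1 : factorialSum (X * (X - 1) ^ (q + 2) * (X - 2) * X ^ p) = factorialSum (φ * X) := by
    rw [show (X : ℝ[X]) * (X - 1) ^ (q + 2) * (X - 2) * X ^ p =
      X * (X - 1) * (X ^ p * (X - 1) ^ (q + 1) * (X - 2)) by ring, shift]
    congr 1
    simp only [mul_comp, X_comp, pow_comp, sub_comp, one_comp, two_comp, hφdef]
    ring
  have e2 : factorialSum (X * (X * (X - 1) ^ (q + 2) * (X - 2) * X ^ p)) =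
      factorialSum (φ * X ^ 2) + 2 * factorialSum (φ * X) := by
    rw [show (X : ℝ[X]) * (X * (X - 1) ^ (q + 2) * (X - 2) * X ^ p) =
      X * (X - 1) * (X ^ p * (X - 1) ^ (q + 1) * (X - 2) * X) by ring, shift,
      ← factorialSum_C_mul, ← factorialSum_add]
    congr 1
    simp only [mul_comp, X_comp, pow_comp, sub_comp, one_comp, two_comp, hφdef, map_ofNat]
    ring
  have e3 : factorialSum (X * (X - 1) ^ (q + 4) * X ^ p) =
      factorialSum (φ * X ^ 2) + 2 * factorialSum (φ * X) + factorialSum φ := by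
    rw [show (X : ℝ[X]) * (X - 1) ^ (q + 4) * X ^ p =
      X * (X - 1) * (X ^ p * (X - 1) ^ (q + 1) * (X - 1) ^ 2) by ring, shift,
      ← factorialSum_C_mul, ← factorialSum_add, ← factorialSum_add]
    congr 1
    simp only [mul_comp, X_comp, pow_comp, sub_comp, one_comp, hφdef, map_ofNat]
    ring
  have e4 : factorialSum (X * (X * (X - 1) ^ (q + 4) * X ^ p)) =
      factorialSum (φ * X ^ 3) + 4 * factorialSum (φ * X ^ 2) + 5 * factorialSum (φ * X)
        + 2 * factorialSum φ := by
    rw [show (X : ℝ[X]) * (X * (X - 1) ^ (q + 4) * X ^ p) =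
      X * (X - 1) * (X ^ p * (X - 1) ^ (q + 1) * (X - 1) ^ 2 * X) by ring, shift,
      ← factorialSum_C_mul, ← factorialSum_C_mul, ← factorialSum_C_mul, ← factorialSum_add,
      ← factorialSum_add, ← factorialSum_add]
    congr 1
    simp only [mul_comp, X_comp, pow_comp, sub_comp, one_comp, hφdef, map_ofNat]
    ring
  have hφ0 : 0 < factorialSum φ := factorialSum_pos (fun k => (hφ k).le) 0 (hφ 0)
  have hψ0 : 0 < factorialSum ψ := hφ0.trans (factorialSum_lt hlt)
  have hψ1 : 0 < factorialSum (φ * X ^ 2) := by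
    refine factorialSum_pos (fun k => ?_) 1 ?_
    · simp only [eval_mul, eval_pow, eval_X]
      exact mul_nonneg (hφ k).le (by positivity)
    · simpa using hφ 1
  rw [e1, e2, e3, e4, div_lt_div_iff₀ (by rw [hm1]; exact hψ0) (by rw [hm1]; positivity), hm3]
  rw [hm1] at hvar ⊢
  have : factorialSum (ψ * X) = factorialSum (φ * X ^ 2) - factorialSum ψ := by linarith
  rw [this] at hvar ⊢
  nlinarith

end PoissonFunctional

section Colorings

/-- The proper colorings of `G` with colors in `Fin x`. -/
abbrev ProperColoring {V : Type*} (G : SimpleGraph V) (x : ℕ) : Type _ :=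
  {f : V → Fin x // ∀ u v, G.Adj u v → f u ≠ f v}

/-- The coloring that gives each block of a partition its own color. -/
def coloringOfParts {V : Type*} [Fintype V] [DecidableEq V] {G : SimpleGraph V} {x : ℕ}
    (P : {P : Finpartition (univ : Finset V) // IsStablePartition G P})
    (e : P.1.parts ↪ Fin x) : ProperColoring G x :=
  ⟨fun v => e ⟨P.1.part v, P.1.part_mem.2 (mem_univ v)⟩, fun u v huv h => by
    have h' : P.1.part u = P.1.part v := congrArg Subtype.val (e.injective h)
    exact P.2 _ (P.1.part_mem.2 (mem_univ u)) u (P.1.mem_part (mem_univ u)) v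
      (by rw [h']; exact P.1.mem_part (mem_univ v)) huv⟩

lemma coloringOfParts_bijective {V : Type*} [Fintype V] [DecidableEq V] (G : SimpleGraph V)
    (x : ℕ) : Function.Bijective fun s : Σ P : {P : Finpartition (univ : Finset V) //
      IsStablePartition G P}, (P.1.parts ↪ Fin x) => coloringOfParts s.1 s.2 := by
  constructor
  · rintro ⟨P, e⟩ ⟨Q, d⟩ h
    have hval : ∀ v, e ⟨P.1.part v, P.1.part_mem.2 (mem_univ v)⟩ =
        d ⟨Q.1.part v, Q.1.part_mem.2 (mem_univ v)⟩ :=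
      fun v => congrFun (congrArg Subtype.val h) v
    have hiff : ∀ u v, P.1.part u = P.1.part v ↔ Q.1.part u = Q.1.part v := by
      intro u v
      have h1 := hval u
      have h2 := hval v
      constructor
      · intro huv
        have : e ⟨P.1.part u, P.1.part_mem.2 (mem_univ u)⟩ =
            e ⟨P.1.part v, P.1.part_mem.2 (mem_univ v)⟩ := by simp only [huv]
        exact congrArg Subtype.val (d.injective (h1.symm.trans (this.trans h2)))
      · intro huv
        have : d ⟨Q.1.part u, Q.1.part_mem.2 (mem_univ u)⟩ =
            d ⟨Q.1.part v, Q.1.part_mem.2 (mem_univ v)⟩ := by simp only [huv]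
        exact congrArg Subtype.val (e.injective (h1.trans (this.trans h2.symm)))
    have hpart : ∀ v, P.1.part v = Q.1.part v := by
      intro v
      ext u
      rw [P.1.mem_part_iff_part_eq_part (mem_univ u) (mem_univ v),
        Q.1.mem_part_iff_part_eq_part (mem_univ u) (mem_univ v)]
      exact hiff _ _
    have hPQ : P = Q := by
      apply Subtype.ext
      apply Finpartition.ext
      ext t
      constructor
      · intro ht
        obtain ⟨v, hv⟩ := P.1.nonempty_of_mem_parts ht
        rw [← P.1.part_eq_of_mem ht hv, hpart]
        exact Q.1.part_mem.2 (mem_univ v)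
      · intro ht
        obtain ⟨v, hv⟩ := Q.1.nonempty_of_mem_parts ht
        rw [← Q.1.part_eq_of_mem ht hv, ← hpart]
        exact P.1.part_mem.2 (mem_univ v)
    subst hPQ
    congr 1
    ext ⟨t, ht⟩
    obtain ⟨v, hv⟩ := P.1.nonempty_of_mem_parts ht
    have ht' := P.1.part_eq_of_mem ht hv
    subst ht'
    rw [hval v]
  · rintro ⟨f, hf⟩
    have : DecidableRel (Setoid.ker f) := fun u v => inferInstanceAs (Decidable (f u = f v))
    let P : Finpartition (univ : Finset V) := Finpartition.ofSetoid (Setoid.ker f)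
    have hker : ∀ u v, u ∈ P.part v ↔ f v = f u := fun u v =>
      Finpartition.mem_part_ofSetoid_iff_rel
    have hconst : ∀ t ∈ P.parts, ∀ u ∈ t, ∀ v ∈ t, f u = f v := by
      intro t ht u hu v hv
      rw [← hker v u, P.part_eq_of_mem ht hu]
      exact hv
    have hP : IsStablePartition G P := fun t ht u hu v hv huv =>
      hf u v huv (hconst t ht u hu v hv)
    let rep : P.parts → V := fun t => (P.nonempty_of_mem_parts t.2).choose
    have hrep : ∀ t : P.parts, rep t ∈ t.1 := fun t => (P.nonempty_of_mem_parts t.2).choose_spec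
    refine ⟨⟨⟨P, hP⟩, ⟨fun t => f (rep t), fun s t hst => ?_⟩⟩, ?_⟩
    · apply Subtype.ext
      rw [← P.part_eq_of_mem s.2 (hrep s)]
      exact P.part_eq_of_mem t.2 (hrep t) ▸ (P.part_eq_of_mem
        (P.part_mem.2 (mem_univ (rep t))) ((hker _ _).2 hst.symm))
    · apply Subtype.ext
      funext v
      exact hconst _ (P.part_mem.2 (mem_univ v)) _ (hrep _) _ (P.mem_part (mem_univ v))

open scoped Classical in
/-- The chromatic polynomial, expanded over coloring partitions in falling factorials. -/
noncomputable def chromaticPoly {V : Type*} [Fintype V] [DecidableEq V] (G : SimpleGraph V) :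
    Polynomial ℝ :=
  ∑ P ∈ univ.filter (IsStablePartition G), descPochhammer ℝ P.parts.card

lemma chromaticPoly_eval {V : Type*} [Fintype V] [DecidableEq V] (G : SimpleGraph V) (x : ℕ) :
    (chromaticPoly G).eval (x : ℝ) = Nat.card (ProperColoring G x) := by
  classical
  rw [← Nat.card_congr (Equiv.ofBijective _ (coloringOfParts_bijective G x)),
    Nat.card_eq_fintype_card, Fintype.card_sigma, chromaticPoly, Polynomial.eval_finsetSum,
    Nat.cast_sum, Finset.sum_subtype (p := IsStablePartition G) _ (by simp)]
  refine Finset.sum_congr rfl fun P _ => ?_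
  rw [descPochhammer_eval_eq_descFactorial, Fintype.card_embedding_eq, Fintype.card_fin,
    Fintype.card_coe]

lemma factorialSum_chromaticPoly {V : Type*} [Fintype V] [DecidableEq V] (G : SimpleGraph V) :
    factorialSum (chromaticPoly G) = colB G * Real.exp 1 := by
  rw [chromaticPoly, factorialSum_sum]
  simp [factorialSum_descPochhammer, colB]

lemma factorialSum_X_mul_chromaticPoly {V : Type*} [Fintype V] [DecidableEq V]
    (G : SimpleGraph V) :
    factorialSum (Polynomial.X * chromaticPoly G) = (colT G + colB G) * Real.exp 1 := by
  rw [chromaticPoly, Finset.mul_sum, factorialSum_sum]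
  simp only [factorialSum_X_mul_descPochhammer, ← Finset.sum_mul, Finset.sum_add_distrib]
  simp [colT, colB]

lemma colB_pos {V : Type*} [Fintype V] [DecidableEq V] (G : SimpleGraph V) : 0 < colB G := by
  classical
  refine Finset.card_pos.2 ⟨⊥, ?_⟩
  simp only [mem_filter, mem_univ, true_and]
  intro t ht u hu v hv
  obtain ⟨w, -, rfl⟩ := Finpartition.mem_bot_iff.1 ht
  rw [mem_singleton] at hu hv
  simp [hu, hv]

/-- The average number of blocks in terms of any polynomial counting proper colorings. -/
lemma colA_eq {V : Type*} [Fintype V] [DecidableEq V] (G : SimpleGraph V) (f : Polynomial ℝ)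
    (hf : ∀ x : ℕ, (Nat.card (ProperColoring G x) : ℝ) = f.eval (x : ℝ)) :
    (colA G : ℝ) = factorialSum (Polynomial.X * f) / factorialSum f - 1 := by
  have h0 : ∀ x : ℕ, (chromaticPoly G).eval (x : ℝ) = f.eval (x : ℝ) := fun x => by
    rw [chromaticPoly_eval, hf]
  have hB : (0 : ℝ) < colB G := by exact_mod_cast colB_pos G
  rw [← factorialSum_congr h0, ← factorialSum_congr (f := Polynomial.X * chromaticPoly G)
    (fun x => by simp only [Polynomial.eval_mul, h0]), factorialSum_chromaticPoly,
    factorialSum_X_mul_chromaticPoly, mul_div_mul_right _ _ (Real.exp_pos 1).ne', colA]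
  push_cast
  field_simp
  ring

lemma card_properColoring_unionIsolated {V : Type*} (G : SimpleGraph V)
    (p x : ℕ) : Nat.card (ProperColoring (unionIsolated G p) x) =
      Nat.card (ProperColoring G x) * x ^ p := by
  have e : ProperColoring (unionIsolated G p) x ≃ ProperColoring G x × (Fin p → Fin x) :=
    { toFun := fun f => (⟨fun v => f.1 (Sum.inl v), fun u v huv => f.2 _ _ (by
          simp only [unionIsolated, fromRel_adj]
          exact ⟨fun h => huv.ne (Sum.inl_injective h), Or.inl ⟨u, v, rfl, rfl, huv⟩⟩)⟩,
        fun i => f.1 (Sum.inr i))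
      invFun := fun g => ⟨Sum.elim g.1.1 g.2, by
        intro u v huv
        simp only [unionIsolated, fromRel_adj] at huv
        rcases huv.2 with ⟨a, b, rfl, rfl, h⟩ | ⟨a, b, rfl, rfl, h⟩
        · exact g.1.2 a b h
        · exact g.1.2 b a h.symm⟩
      left_inv := fun f => Subtype.ext (Sum.elim_comp_inl_inr f.1)
      right_inv := fun g => rfl }
  rw [Nat.card_congr e, Nat.card_prod, Nat.card_fun]
  simp

/-- The color sequences that may follow a vertex of color `a` along a path of `r` vertices. -/
abbrev PathExtension (x r : ℕ) (a : Fin x) : Type :=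
  {g : Fin r → Fin x // ∀ i : Fin r, (Fin.cons a g : Fin (r + 1) → Fin x) i.castSucc ≠ g i}

lemma card_pathExtension (x r : ℕ) (a : Fin x) :
    Nat.card (PathExtension x r a) = (x - 1) ^ r := by
  induction r generalizing a with
  | zero =>
    rw [pow_zero, Nat.card_eq_one_iff_unique]
    exact ⟨⟨fun f g => Subtype.ext (Subsingleton.elim _ _)⟩, ⟨⟨Fin.elim0, fun i => i.elim0⟩⟩⟩
  | succ r ih =>
    have e : PathExtension x (r + 1) a ≃ Σ b : {b : Fin x // b ≠ a}, PathExtension x r b.1 :=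
      { toFun := fun g => ⟨⟨g.1 0, (g.2 0).symm⟩, ⟨Fin.tail g.1, fun i => by
          have := g.2 i.succ
          rw [Fin.cons_self_tail]
          simpa [Fin.tail, ← Fin.succ_castSucc] using this⟩⟩
        invFun := fun s => ⟨Fin.cons s.1.1 s.2.1, fun i => by
          refine Fin.cases ?_ (fun i => ?_) i
          · simpa using s.1.2.symm
          · simpa [← Fin.succ_castSucc] using s.2.2 i⟩
        left_inv := fun g => Subtype.ext (Fin.cons_self_tail g.1)
        right_inv := fun s => rfl }
    rw [Nat.card_congr e, Nat.card_sigma]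
    simp only [ih, sum_const, card_univ, smul_eq_mul, pow_succ']
    simp

lemma card_properColoring_pathGraph (n x : ℕ) :
    Nat.card (ProperColoring (pathGraph (n + 1)) x) = x * (x - 1) ^ n := by
  have e : ProperColoring (pathGraph (n + 1)) x ≃ Σ a : Fin x, PathExtension x n a :=
    { toFun := fun f => ⟨f.1 0, ⟨Fin.tail f.1, fun i => by
        rw [Fin.cons_self_tail]
        exact f.2 _ _ (by simp [pathGraph_adj])⟩⟩
      invFun := fun s => ⟨Fin.cons s.1 s.2.1, by
        have hstep : ∀ u v : Fin (n + 1), u.val + 1 = v.val →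
            (Fin.cons s.1 s.2.1 : Fin (n + 1) → Fin x) u ≠
              (Fin.cons s.1 s.2.1 : Fin (n + 1) → Fin x) v := by
          intro u v huv
          obtain ⟨i, rfl⟩ := Fin.exists_succ_eq.2 (show v ≠ 0 by rintro rfl; simp at huv)
          obtain rfl : u = i.castSucc := Fin.ext (by simpa using huv)
          simpa using s.2.2 i
        intro u v huv
        rcases pathGraph_adj.1 huv with h | h
        · exact hstep u v h
        · exact (hstep v u h).symm⟩
      left_inv := fun f => Subtype.ext (Fin.cons_self_tail f.1)
      right_inv := fun s => rfl }
  rw [Nat.card_congr e, Nat.card_sigma]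
  simp only [card_pathExtension, sum_const, card_univ, smul_eq_mul, Fintype.card_fin]

lemma card_properColoring_Hgraph (r x : ℕ) :
    Nat.card (ProperColoring (Hgraph 3 r) x) = x.descFactorial 3 * (x - 1) ^ r := by
  have hcycle : ∀ a b : Fin 3, (cycleGraph 3).Adj a b ↔ a ≠ b := by
    rw [cycleGraph_three_eq_top]
    simp
  have e : ProperColoring (Hgraph 3 r) x ≃ Σ c : Fin 3 ↪ Fin x, PathExtension x r (c 0) :=
    { toFun := fun f => ⟨⟨fun a => f.1 (Sum.inl a), fun a b hab => by
          by_contra hne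
          refine f.2 (Sum.inl a) (Sum.inl b) ?_ hab
          simp only [Hgraph, fromRel_adj]
          exact ⟨fun h => hne (Sum.inl_injective h),
            Or.inl (Or.inl ⟨a, b, rfl, rfl, (hcycle a b).2 hne⟩)⟩⟩,
        ⟨fun i => f.1 (Sum.inr i), fun i => by
          obtain ⟨i, hi⟩ := i
          cases i with
          | zero =>
            refine f.2 (Sum.inl 0) (Sum.inr _) ?_
            simp only [Hgraph, fromRel_adj]
            exact ⟨by simp, Or.inl (Or.inr (Or.inr ⟨0, ⟨0, hi⟩, rfl, rfl, rfl, rfl⟩))⟩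
          | succ i =>
            refine f.2 (Sum.inr ⟨i, by omega⟩) (Sum.inr _) ?_
            simp only [Hgraph, fromRel_adj]
            refine ⟨by simp, Or.inl (Or.inr (Or.inl ⟨_, _, rfl, rfl, ?_⟩))⟩
            simp [pathGraph_adj]⟩⟩
      invFun := fun s => ⟨Sum.elim s.1 s.2.1, by
        have hpath : ∀ a b : Fin r, a.val + 1 = b.val → s.2.1 a ≠ s.2.1 b := by
          rintro ⟨a, ha⟩ ⟨b, hb⟩ hab
          obtain rfl : a + 1 = b := hab
          exact s.2.2 ⟨a + 1, hb⟩
        have hrel : ∀ u v : Fin 3 ⊕ Fin r,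
            ((∃ a b, u = Sum.inl a ∧ v = Sum.inl b ∧ (cycleGraph 3).Adj a b) ∨
            (∃ a b, u = Sum.inr a ∧ v = Sum.inr b ∧ (pathGraph r).Adj a b) ∨
            (∃ (a : Fin 3) (b : Fin r), a.val = 0 ∧ b.val = 0 ∧ u = Sum.inl a ∧ v = Sum.inr b)) →
            Sum.elim s.1 s.2.1 u ≠ Sum.elim s.1 s.2.1 v := by
          rintro u v (⟨a, b, rfl, rfl, h⟩ | ⟨a, b, rfl, rfl, h⟩ | ⟨a, b, ha, hb, rfl, rfl⟩)
          · exact fun h' => (hcycle a b).1 h (s.1.injective h')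
          · rcases pathGraph_adj.1 h with h | h
            · exact hpath a b h
            · exact (hpath b a h).symm
          · obtain rfl : a = 0 := Fin.ext ha
            obtain ⟨b, hb'⟩ := b
            obtain rfl : b = 0 := hb
            exact s.2.2 ⟨0, hb'⟩
        intro u v huv
        simp only [Hgraph, fromRel_adj] at huv
        rcases huv.2 with h | h
        · exact hrel u v h
        · exact (hrel v u h).symm⟩
      left_inv := fun f => Subtype.ext (Sum.elim_comp_inl_inr f.1)
      right_inv := fun s => rfl }
  rw [Nat.card_congr e, Nat.card_sigma]
  simp only [card_pathExtension, sum_const, card_univ, smul_eq_mul, Fintype.card_embedding_eq,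
    Fintype.card_fin]

end Colorings

/-- For all `n ≥ 4` and `p ≥ 0`, `A(H_{3,n-3} ∪ pK₁) < A(P_{n+1} ∪ pK₁)`. -/
theorem stmt_10 (n p : ℕ) (hn : 4 ≤ n) :
    colA (unionIsolated (Hgraph 3 (n - 3)) p) <
      colA (unionIsolated (pathGraph (n + 1)) p) := by
  obtain ⟨q, rfl⟩ : ∃ q, n = q + 4 := ⟨n - 4, by omega⟩
  have hcast : ∀ x m : ℕ, (x : ℝ) * ((x - 1 : ℕ) : ℝ) ^ m = (x : ℝ) * ((x : ℝ) - 1) ^ m := by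
    intro x m
    cases x <;> simp
  have hH := colA_eq (unionIsolated (Hgraph 3 (q + 4 - 3)) p)
    (Polynomial.X * (Polynomial.X - 1) ^ (q + 2) * (Polynomial.X - 2) * Polynomial.X ^ p) (by
      intro x
      rw [card_properColoring_unionIsolated, card_properColoring_Hgraph]
      have h3 : ((x.descFactorial 3 : ℕ) : ℝ) = x * (x - 1) * (x - 2) := by
        rw [← descPochhammer_eval_eq_descFactorial]
        simp [descPochhammer_succ_right]
      have := hcast x (q + 1)
      push_cast
      simp only [h3, Polynomial.eval_mul, Polynomial.eval_pow, Polynomial.eval_sub,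
        Polynomial.eval_X, Polynomial.eval_one, Polynomial.eval_ofNat]
      linear_combination ((x : ℝ) - 1) * (x - 2) * x ^ p * this)
  have hP := colA_eq (unionIsolated (pathGraph (q + 4 + 1)) p)
    (Polynomial.X * (Polynomial.X - 1) ^ (q + 4) * Polynomial.X ^ p) (by
      intro x
      rw [card_properColoring_unionIsolated, card_properColoring_pathGraph]
      push_cast
      simp [hcast])
  have hlt := factorialSum_ratio_lt p q
  rw [← Rat.cast_lt (K := ℝ), hH, hP]
  linarith
end

section
/- For all integers n ≥ 4 and p ≥ 0, (Σ_{j=1}^{n−1} (−1)^{j+1} Σ_{i=0}^{p} C(p,i) B_{n+i−j+1}) · (Σ_{i=0}^{p} C(p,i) (B_{n+i−1} − B_{n+i−2})) < (Σ_{j=1}^{n−1} (−1)^{j+1} Σ_{i=0}^{p} C(p,i) B_{n+i−j}) · (Σ_{i=0}^{p} C(p,i) (B_{n+i} − B_{n+i−1})), where C(p,i) is the binomial coefficient and B_k is the k-th Bell number, and the inequality is between integers. -/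
open Finset SimpleGraph

/-- Partitions of `insert a s` correspond to partitions of subsets of `s`, by removing the part
containing `a`. -/
theorem Finpartition.card_insert {α : Type*} [DecidableEq α] {s : Finset α} {a : α}
    (ha : a ∉ s) :
    Fintype.card (Finpartition (insert a s)) =
      ∑ t ∈ s.powerset, Fintype.card (Finpartition t) := by
  have hmem (t : s.powerset) : a ∉ t.1 := fun h ↦ ha (mem_powerset.1 t.2 h)
  have hsub (t : s.powerset) : t.1 ⊆ insert a s :=
    (mem_powerset.1 t.2).trans (subset_insert a s)
  have hne (t : s.powerset) : insert a s \ t.1 ≠ ⊥ :=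
    ne_empty_of_mem (mem_sdiff.2 ⟨mem_insert_self a s, hmem t⟩)
  let f : (Σ t : s.powerset, Finpartition t.1) → Finpartition (insert a s) := fun x ↦
    x.2.extend (hne x.1) disjoint_sdiff (union_sdiff_of_subset (hsub x.1))
  have hf (x) : (f x).parts = insert (insert a s \ x.1.1) x.2.parts := rfl
  have hnot (x : Σ t : s.powerset, Finpartition t.1) : insert a s \ x.1.1 ∉ x.2.parts := fun h ↦
    hmem x.1 (x.2.le h (mem_sdiff.2 ⟨mem_insert_self a s, hmem x.1⟩))
  have hpart (x) : (f x).part a = insert a s \ x.1.1 :=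
    (f x).part_eq_of_mem (by rw [hf]; exact mem_insert_self _ _)
      (mem_sdiff.2 ⟨mem_insert_self a s, hmem x.1⟩)
  have hbij : Function.Bijective f := by
    constructor
    · intro x y hxy
      have h1 : x.1 = y.1 := by
        apply Subtype.ext
        rw [← Finset.sdiff_sdiff_eq_self (hsub x.1), ← Finset.sdiff_sdiff_eq_self (hsub y.1),
          ← hpart, ← hpart, hxy]
      obtain ⟨t, P⟩ := x
      obtain ⟨t', Q⟩ := y
      obtain rfl : t = t' := h1
      congr 1
      ext1
      rw [← erase_insert (hnot ⟨t, P⟩), ← erase_insert (hnot ⟨t, Q⟩), ← hf, ← hf, hxy]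
    · intro P
      have hpa : P.part a ∈ P.parts := P.part_mem.2 (mem_insert_self a s)
      have hsup : (P.parts.erase (P.part a)).sup id = insert a s \ P.part a := by
        ext x
        simp only [mem_sup, mem_erase, id, mem_sdiff]
        constructor
        · rintro ⟨t, ⟨hta, ht⟩, hx⟩
          exact ⟨P.le ht hx, fun h ↦ hta (P.eq_of_mem_parts ht hpa hx h)⟩
        · rintro ⟨hx, hxa⟩
          obtain ⟨t, ht, hxt⟩ := P.exists_mem hx
          exact ⟨t, ⟨fun h ↦ hxa (h ▸ hxt), ht⟩, hxt⟩
      have hta : insert a s \ P.part a ⊆ s := by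
        intro x hx
        obtain ⟨hx, hxa⟩ := mem_sdiff.1 hx
        refine (mem_insert.1 hx).resolve_left ?_
        rintro rfl
        exact hxa (P.mem_part hx)
      refine ⟨⟨⟨_, mem_powerset.2 hta⟩, P.ofSubset (erase_subset _ _) hsup⟩, ?_⟩
      ext1
      rw [hf]
      simp only [Finpartition.ofSubset_parts]
      rw [Finset.sdiff_sdiff_eq_self (P.part_subset a), insert_erase hpa]
  rw [← Fintype.card_of_bijective hbij, Fintype.card_sigma,
    ← sum_coe_sort s.powerset fun t ↦ Fintype.card (Finpartition t)]

theorem natBell_succ_eq_sum_choose (n : ℕ) :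
    (n + 1).bell = ∑ i ∈ range (n + 1), n.choose i * i.bell := by
  rw [Nat.bell_succ', ← Nat.sum_antidiagonal_swap, Nat.sum_antidiagonal_eq_sum_range_succ_mk]
  refine sum_congr rfl fun k hk ↦ ?_
  simp [Nat.choose_symm (Nat.lt_succ_iff.1 (mem_range.1 hk))]

theorem Finpartition.card_eq_bell {α : Type*} [DecidableEq α] (s : Finset α) :
    Fintype.card (Finpartition s) = Nat.bell #s := by
  induction s using Finset.strongInduction with
  | H s ih =>
    obtain rfl | ⟨a, ha⟩ := s.eq_empty_or_nonempty
    · rw [card_empty, Nat.bell_zero, ← bot_eq_empty]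
      exact Fintype.card_unique
    · obtain ⟨s, ha', rfl⟩ : ∃ t, a ∉ t ∧ s = insert a t :=
        ⟨s.erase a, notMem_erase a s, (insert_erase ha).symm⟩
      rw [card_insert ha', card_insert_of_notMem ha', natBell_succ_eq_sum_choose,
        Finset.sum_congr rfl fun t ht ↦
          ih t ((mem_powerset.1 ht).trans_ssubset (ssubset_insert ha')),
        sum_powerset_apply_card]
      rfl

theorem bell_eq_natBell (n : ℕ) : bell n = n.bell := by
  rw [bell, Finpartition.card_eq_bell, card_univ, Fintype.card_fin]

/-- Dobiński's formula. -/
theorem hasSum_pow_div_factorial (n : ℕ) :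
    HasSum (fun k : ℕ ↦ (k : ℝ) ^ n / k.factorial) (Real.exp 1 * n.bell) := by
  induction n using Nat.strong_induction_on with
  | _ n ih =>
    cases n with
    | zero =>
      simpa [Real.exp_eq_exp_ℝ] using NormedSpace.expSeries_div_hasSum_exp (1 : ℝ)
    | succ n =>
      rw [← hasSum_nat_add_iff' 1]
      have h := hasSum_sum fun i (hi : i ∈ range (n + 1)) ↦
        (ih i (mem_range.1 hi)).mul_left (n.choose i : ℝ)
      convert! h using 1
      · ext k
        rw [Nat.factorial_succ]
        push_cast
        rw [pow_succ', mul_div_mul_left _ _ (by positivity), add_pow, sum_div]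
        exact sum_congr rfl fun i _ ↦ by rw [one_pow]; ring
      · rw [natBell_succ_eq_sum_choose]
        push_cast
        rw [mul_sum, sum_range_one]
        simp only [CharP.cast_eq_zero, pow_succ, mul_zero, zero_div, sub_zero]
        exact sum_congr rfl fun i _ ↦ by ring

/-- The moments of the measure with weight `(k + 1) ^ p / k!` at `k`. -/
theorem hasSum_pow_mul_add_one_pow_div_factorial (m p : ℕ) :
    HasSum (fun k : ℕ ↦ (k : ℝ) ^ m * (((k : ℝ) + 1) ^ p / k.factorial))
      (Real.exp 1 * ∑ i ∈ range (p + 1), (p.choose i : ℝ) * bell (m + i)) := by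
  have h := hasSum_sum fun i (_ : i ∈ range (p + 1)) ↦
    (hasSum_pow_div_factorial (m + i)).mul_left (p.choose i : ℝ)
  convert! h using 1
  · ext k
    rw [add_pow, sum_div, mul_sum]
    exact sum_congr rfl fun i _ ↦ by rw [one_pow]; ring
  · rw [mul_sum]
    exact sum_congr rfl fun i _ ↦ by rw [bell_eq_natBell]; ring

/-- If `g / f` is nondecreasing and not constant, then the mean of the identity with respect to the
weights `g` exceeds its mean with respect to the weights `f`. -/
theorem mul_lt_mul_of_hasSum_of_cross {f g : ℕ → ℝ} {F F' G G' : ℝ}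
    (hf : HasSum f F) (hf' : HasSum (fun k ↦ k * f k) F')
    (hg : HasSum g G) (hg' : HasSum (fun k ↦ k * g k) G')
    (hcross : ∀ x y : ℕ, x ≤ y → f y * g x ≤ f x * g y)
    {x₀ y₀ : ℕ} (h₀ : x₀ < y₀) (hlt : f y₀ * g x₀ < f x₀ * g y₀) :
    F' * G < F * G' := by
  have hprod {u v : ℕ → ℝ} {U V : ℝ} (hu : HasSum u U) (hv : HasSum v V) :
      HasSum (fun z : ℕ × ℕ ↦ u z.1 * v z.2) (U * V) :=
    hu.mul hv (summable_mul_of_summable_norm hu.summable.norm hv.summable.norm)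
  have h1 := (hprod hf hg').sub (hprod hf' hg)
  have h2 := h1.add ((Equiv.prodComm ℕ ℕ).hasSum_iff.2 h1)
  have hterm (x y : ℕ) : 0 ≤ ((y : ℝ) - x) * (f x * g y - f y * g x) := by
    rcases le_total x y with h | h
    · exact mul_nonneg (sub_nonneg.2 (Nat.cast_le.2 h)) (sub_nonneg.2 (hcross x y h))
    · exact mul_nonneg_of_nonpos_of_nonpos (sub_nonpos.2 (Nat.cast_le.2 h))
        (by linarith [hcross y x h])
  have h3 := hasSum_lt (i := (x₀, y₀)) (f := fun _ ↦ (0 : ℝ)) (fun z ↦ ?_) ?_ hasSum_zero h2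
  · linarith
  · have := hterm z.1 z.2
    simp only [Function.comp_apply, Equiv.prodComm_apply, Prod.fst_swap, Prod.snd_swap]
    linarith
  · have : 0 < ((y₀ : ℝ) - x₀) * (f x₀ * g y₀ - f y₀ * g x₀) :=
      mul_pos (sub_pos.2 (Nat.cast_lt.2 h₀)) (sub_pos.2 hlt)
    simp only [Function.comp_apply, Equiv.prodComm_apply, Prod.swap_prod_mk]
    linarith

theorem alternating_sum_mul_add_one (m : ℕ) (x : ℝ) :
    (∑ j ∈ Icc 1 m, (-1 : ℝ) ^ (j + 1) * x ^ (m - j)) * (x + 1) = x ^ m - (-1) ^ m := by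
  induction m with
  | zero => simp
  | succ m ih =>
    have h : ∑ j ∈ Icc 1 m, (-1 : ℝ) ^ (j + 1) * x ^ (m + 1 - j) =
        x * ∑ j ∈ Icc 1 m, (-1 : ℝ) ^ (j + 1) * x ^ (m - j) := by
      rw [mul_sum]
      refine sum_congr rfl fun j hj ↦ ?_
      rw [Nat.sub_add_comm (mem_Icc.1 hj).2, pow_succ]
      ring
    rw [sum_Icc_succ_top (by omega), h, add_mul, mul_assoc, ih]
    simp only [Nat.sub_self, pow_succ]
    ring

theorem pow_sub_mul_lt_pow_sub_mul {m : ℕ} (hm : 1 ≤ m) {x y : ℕ} (hx : 2 ≤ x) (hxy : x < y)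
    {e : ℝ} (he : e = 1 ∨ e = -1) :
    ((y : ℝ) ^ (m + 2) - e) * (x ^ m * (x ^ 2 - 1)) <
      ((x : ℝ) ^ (m + 2) - e) * (y ^ m * (y ^ 2 - 1)) := by
  have hx2 : (2 : ℝ) ≤ x := by exact_mod_cast hx
  have hxy' : (x : ℝ) + 1 ≤ y := by exact_mod_cast hxy
  have ha : (x : ℝ) ≤ x ^ m := le_self_pow₀ (by linarith) (by omega)
  have hab : (x : ℝ) ^ m ≤ y ^ m := by gcongr
  have hsq : (x : ℝ) ^ 2 < y ^ 2 := by gcongr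
  have hsx : 0 < (x : ℝ) ^ 2 - 1 := by nlinarith
  rw [pow_add, pow_add]
  set a := (x : ℝ) ^ m
  set b := (y : ℝ) ^ m
  have ha0 : 0 < a := by linarith
  have hb0 : 0 < b := by linarith
  rcases he with rfl | rfl
  · have h2 : 0 ≤ (x : ℝ) * (y ^ 2 - x ^ 2) - (y ^ 2 - 1) := by
      have : ((x : ℝ) + 1) ^ 2 ≤ y ^ 2 := by gcongr
      nlinarith [mul_le_mul_of_nonneg_left this (by linarith : (0 : ℝ) ≤ x - 1)]
    have h3 := mul_nonneg (sub_nonneg.2 ha) (sub_nonneg.2 hsq.le)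
    have h4 : 0 ≤ b * (a * ((y : ℝ) ^ 2 - x ^ 2) - (y ^ 2 - 1)) :=
      mul_nonneg hb0.le (by linarith)
    nlinarith [mul_pos ha0 hsx]
  · have h1 := mul_pos (mul_pos ha0 hb0) (sub_pos.2 hsq)
    have : a * ((x : ℝ) ^ 2 - 1) ≤ b * (y ^ 2 - 1) := by gcongr
    nlinarith

theorem pow_sub_mul_le_pow_sub_mul {m : ℕ} (hm : 1 ≤ m) {x y : ℕ} (hx : 1 ≤ x) (hxy : x ≤ y)
    {e : ℝ} (he : e = 1 ∨ e = -1) :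
    ((y : ℝ) ^ (m + 2) - e) * (x ^ m * (x ^ 2 - 1)) ≤
      ((x : ℝ) ^ (m + 2) - e) * (y ^ m * (y ^ 2 - 1)) := by
  rcases hxy.eq_or_lt with rfl | hlt
  · exact le_rfl
  rcases hx.eq_or_lt with rfl | hx2
  · have hy : (1 : ℝ) ≤ y := by exact_mod_cast hxy
    have he1 : 0 ≤ 1 - e := by rcases he with rfl | rfl <;> norm_num
    have hy2 : 0 ≤ (y : ℝ) ^ 2 - 1 := by nlinarith
    simpa using mul_nonneg he1 (mul_nonneg (by positivity) hy2)
  · exact (pow_sub_mul_lt_pow_sub_mul hm hx2 hlt he).le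

/-- The real form of the inequality, in terms of the moments `M t` of the measure with weight
`(k + 1) ^ p / k!` at `k`. -/
theorem bell_moment_inequality (m p : ℕ) (hm : 1 ≤ m) (M : ℕ → ℝ)
    (hM : ∀ t, M t = ∑ i ∈ range (p + 1), (p.choose i : ℝ) * bell (t + i)) :
    (∑ j ∈ Icc 1 (m + 2), (-1 : ℝ) ^ (j + 1) * M (m + 3 - j + 1)) * (M (m + 2) - M (m + 1)) <
      (∑ j ∈ Icc 1 (m + 2), (-1 : ℝ) ^ (j + 1) * M (m + 3 - j)) * (M (m + 3) - M (m + 2)) := by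
  set w : ℕ → ℝ := fun k ↦ ((k : ℝ) + 1) ^ p / k.factorial
  have hw0 (k) : 0 < w k := by positivity
  have hmom (t : ℕ) : HasSum (fun k : ℕ ↦ (k : ℝ) ^ t * w k) (Real.exp 1 * M t) := by
    rw [hM]
    exact hasSum_pow_mul_add_one_pow_div_factorial t p
  let q : ℝ → ℝ := fun x ↦ ∑ j ∈ Icc 1 (m + 2), (-1 : ℝ) ^ (j + 1) * x ^ (m + 2 - j)
  have hq (x : ℝ) : q x * (x + 1) = x ^ (m + 2) - (-1) ^ (m + 2) :=
    alternating_sum_mul_add_one (m + 2) x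
  let f : ℕ → ℝ := fun k ↦ k * q k * w k
  let g : ℕ → ℝ := fun k ↦ ((k : ℝ) ^ (m + 2) - k ^ (m + 1)) * w k
  have hf : HasSum f (Real.exp 1 * ∑ j ∈ Icc 1 (m + 2), (-1 : ℝ) ^ (j + 1) * M (m + 3 - j)) := by
    convert! hasSum_sum fun j (_ : j ∈ Icc 1 (m + 2)) ↦
      (hmom (m + 3 - j)).mul_left ((-1 : ℝ) ^ (j + 1)) using 1
    · ext k
      simp only [f, q]
      rw [mul_sum, sum_mul]
      refine sum_congr rfl fun j hj ↦ ?_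
      rw [show m + 3 - j = m + 2 - j + 1 by have := mem_Icc.1 hj; omega, pow_succ]
      ring
    · rw [mul_sum]
      exact sum_congr rfl fun i _ ↦ by ring
  have hf' : HasSum (fun k ↦ k * f k)
      (Real.exp 1 * ∑ j ∈ Icc 1 (m + 2), (-1 : ℝ) ^ (j + 1) * M (m + 3 - j + 1)) := by
    convert! hasSum_sum fun j (_ : j ∈ Icc 1 (m + 2)) ↦
      (hmom (m + 3 - j + 1)).mul_left ((-1 : ℝ) ^ (j + 1)) using 1
    · ext k
      simp only [f, q]
      rw [mul_sum, sum_mul, mul_sum]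
      refine sum_congr rfl fun j hj ↦ ?_
      rw [show m + 3 - j = m + 2 - j + 1 by have := mem_Icc.1 hj; omega, pow_succ, pow_succ]
      ring
    · rw [mul_sum]
      exact sum_congr rfl fun i _ ↦ by ring
  have hg : HasSum g (Real.exp 1 * (M (m + 2) - M (m + 1))) := by
    convert! (hmom (m + 2)).sub (hmom (m + 1)) using 1
    · ext k
      simp only [g]
      ring
    · ring
  have hg' : HasSum (fun k ↦ k * g k) (Real.exp 1 * (M (m + 3) - M (m + 2))) := by
    convert! (hmom (m + 3)).sub (hmom (m + 2)) using 1
    · ext k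
      simp only [g]
      ring
    · ring
  have he : ((-1 : ℝ) ^ (m + 2) = 1) ∨ ((-1 : ℝ) ^ (m + 2) = -1) := neg_one_pow_eq_or ℝ _
  have hfg (x y : ℕ) : f x * g y * (((x : ℝ) + 1) * (y + 1)) = x * y * (w x * w y) *
      (((x : ℝ) ^ (m + 2) - (-1) ^ (m + 2)) * (y ^ m * (y ^ 2 - 1))) := by
    rw [← hq]
    simp only [f, g]
    ring
  have key := mul_lt_mul_of_hasSum_of_cross hf hf' hg hg' (x₀ := 2) (y₀ := 3)
    (fun x y hxy ↦ ?_) (by norm_num) ?_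
  · have he2 : 0 < Real.exp 1 * Real.exp 1 := by positivity
    refine lt_of_mul_lt_mul_left (lt_of_eq_of_lt ?_ (key.trans_eq ?_)) he2.le <;> ring
  · rcases x.eq_zero_or_pos with rfl | hx
    · simp [f, g]
    refine le_of_mul_le_mul_right ?_ (by positivity : 0 < ((x : ℝ) + 1) * (y + 1))
    have := mul_le_mul_of_nonneg_left (pow_sub_mul_le_pow_sub_mul hm hx hxy he)
      (by have := hw0 x; have := hw0 y; positivity : 0 ≤ (x : ℝ) * y * (w x * w y))
    have hyx := hfg y x
    have hxy := hfg x y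
    linarith
  · refine lt_of_mul_lt_mul_right ?_ (by positivity : 0 ≤ (((2 : ℕ) : ℝ) + 1) * ((3 : ℕ) + 1))
    have := mul_lt_mul_of_pos_left
      (pow_sub_mul_lt_pow_sub_mul hm (le_refl 2) (Nat.lt_succ_self 2) he)
      (by have := hw0 2; have := hw0 3; positivity :
        0 < ((2 : ℕ) : ℝ) * (3 : ℕ) * (w 2 * w 3))
    have h32 := hfg 3 2
    have h23 := hfg 2 3
    linarith

/-- For all `n ≥ 4` and `p ≥ 0`,
`(∑_{j=1}^{n-1} (-1)^{j+1} ∑ C(p,i) B_{n+i-j+1}) (∑ C(p,i)(B_{n+i-1}-B_{n+i-2})) <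
 (∑_{j=1}^{n-1} (-1)^{j+1} ∑ C(p,i) B_{n+i-j}) (∑ C(p,i)(B_{n+i}-B_{n+i-1}))`. -/
theorem stmt_15 (n p : ℕ) (hn : 4 ≤ n) :
    (∑ j ∈ Finset.Icc 1 (n - 1), (-1 : ℤ) ^ (j + 1) *
        ∑ i ∈ Finset.range (p + 1), p.choose i * bell (n + i - j + 1)) *
      (∑ i ∈ Finset.range (p + 1), (p.choose i : ℤ) *
        ((bell (n + i - 1) : ℤ) - bell (n + i - 2))) <
    (∑ j ∈ Finset.Icc 1 (n - 1), (-1 : ℤ) ^ (j + 1) *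
        ∑ i ∈ Finset.range (p + 1), p.choose i * bell (n + i - j)) *
      (∑ i ∈ Finset.range (p + 1), (p.choose i : ℤ) *
        ((bell (n + i) : ℤ) - bell (n + i - 1))) := by
  obtain ⟨m, rfl⟩ : ∃ m, n = m + 3 := ⟨n - 3, by omega⟩
  rw [← Int.cast_lt (R := ℝ)]
  push_cast
  refine lt_of_eq_of_lt (congrArg₂ (· * ·) ?_ ?_)
    ((bell_moment_inequality m p (by omega) _ fun _ ↦ rfl).trans_eq
      (congrArg₂ (· * ·) ?_ ?_))
  · refine sum_congr rfl fun j hj ↦ congrArg _ (sum_congr rfl fun i _ ↦ ?_)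
    have := mem_Icc.1 hj
    rw [show m + 3 + i - j + 1 = m + 3 - j + 1 + i by omega]
  · rw [← sum_sub_distrib]
    refine sum_congr rfl fun i _ ↦ ?_
    rw [← mul_sub, show m + 3 + i - 1 = m + 2 + i by omega,
      show m + 3 + i - 2 = m + 1 + i by omega]
  · refine sum_congr rfl fun j hj ↦ congrArg _ (sum_congr rfl fun i _ ↦ ?_)
    have := mem_Icc.1 hj
    rw [show m + 3 + i - j = m + 3 - j + i by omega]
  · rw [← sum_sub_distrib]
    refine sum_congr rfl fun i _ ↦ ?_
    rw [← mul_sub, show m + 3 + i - 1 = m + 2 + i by omega]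
end
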